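/- arXiv:1506.06994 — 3 statements merged into one kernel-verified Lean document; each statement's English description precedes it below -/
import Mathlib

section
/- Let n ≥ 1, 0 < λ ≤ Λ, m ∈ [1,2] and s > m, and set μ = 2/(s−1) if 1 ≤ m ≤ 2s/(s+1) and μ = m/(s−m) if 2s/(s+1) < m. Let F : ℝⁿ × Sⁿ → ℝ (Sⁿ the symmetric n×n real matrices) satisfy λ·Tr(Y) ≤ F(x,X+Y) − F(x,X) ≤ Λ·Tr(Y) for all x, all X ∈ Sⁿ and all positive semidefinite Y ∈ Sⁿ, F(x,0) = 0, and x ↦ F(x,X) continuous for each X. Let H : ℝⁿ × ℝⁿ → ℝ be continuous with H(x,0) = 0 and satisfy, for some constants γ₁, γ_m > 0, |H(x,p) − H(x,q)| ≤ (γ₁ + γ_m(|p|^{m−1} + |q|^{m−1}))|p−q| for all p, q, x ∈ ℝⁿ. Let f : ℝⁿ → ℝ be continuous, let ρ ≥ 0 and suppose limsup_{|x|→∞} f⁻(x)/|x|^ρ < ∞. Then every continuous viscosity subsolution u of F(x,D²u) + H(x,Du) − |u|^{s−1}u = f(x) in ℝⁿ satisfies limsup_{|x|→∞} (u⁺(x))^s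 / |x|^{μsρ/2} < ∞. -/
noncomputable section
open Real

abbrev En (n : ℕ) := EuclideanSpace ℝ (Fin n)

/-- A modulus of continuity. -/
def IsModulus (ω : ℝ → ℝ) : Prop :=
  (∀ t, 0 ≤ t → 0 ≤ ω t) ∧ MonotoneOn ω (Set.Ici 0) ∧ ω 0 = 0 ∧
    ContinuousWithinAt ω (Set.Ici 0) 0

/-- The Hessian matrix of a function. -/
def hessianMatrix {n : ℕ} (φ : En n → ℝ) (x : En n) : Matrix (Fin n) (Fin n) ℝ :=
  fun i j =>
    iteratedFDeriv ℝ 2 φ x ![EuclideanSpace.single i 1, EuclideanSpace.single j 1]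

/-- Viscosity subsolution of `F(x,D²u) + H(x,Du) - |u|^{s-1}u = f(x)` in `ℝⁿ`. -/
def ViscositySubsolution {n : ℕ} (F : En n → Matrix (Fin n) (Fin n) ℝ → ℝ)
    (H : En n → En n → ℝ) (s : ℝ) (f : En n → ℝ) (u : En n → ℝ) : Prop :=
  ∀ φ : En n → ℝ, ContDiff ℝ 2 φ → ∀ x₀ : En n, IsLocalMax (u - φ) x₀ →
    F x₀ (hessianMatrix φ x₀) + H x₀ (gradient φ x₀)
      - |u x₀| ^ (s - 1) * u x₀ ≥ f x₀

def ViscositySupersolution {n : ℕ} (F : En n → Matrix (Fin n) (Fin n) ℝ → ℝ)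
    (H : En n → En n → ℝ) (s : ℝ) (f : En n → ℝ) (u : En n → ℝ) : Prop :=
  ∀ φ : En n → ℝ, ContDiff ℝ 2 φ → ∀ x₀ : En n, IsLocalMin (u - φ) x₀ →
    F x₀ (hessianMatrix φ x₀) + H x₀ (gradient φ x₀)
      - |u x₀| ^ (s - 1) * u x₀ ≤ f x₀

/-- The Pucci maximal operator. -/
def pucci (lam Lam : ℝ) {n : ℕ} (X : Matrix (Fin n) (Fin n) ℝ) : ℝ :=
  sSup ((fun A : Matrix (Fin n) (Fin n) ℝ => (A * X).trace) ''
    {A | A.IsSymm ∧ (A - lam • (1 : Matrix (Fin n) (Fin n) ℝ)).PosSemidef ∧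
      (Lam • (1 : Matrix (Fin n) (Fin n) ℝ) - A).PosSemidef})

/-- The subsolution test with a function which is `C²` near a point only. -/
lemma test_local {n : ℕ} {F : En n → Matrix (Fin n) (Fin n) ℝ → ℝ}
    {H : En n → En n → ℝ} {s : ℝ} {f u : En n → ℝ} (husub : ViscositySubsolution F H s f u)
    {ψ : En n → ℝ} {U : Set (En n)} (hU : IsOpen U) (hψ : ContDiffOn ℝ 2 ψ U)
    {x : En n} (hx : x ∈ U) (hmax : IsLocalMax (u - ψ) x) :
    F x (hessianMatrix ψ x) + H x (gradient ψ x) - |u x| ^ (s - 1) * u x ≥ f x := by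
  obtain ⟨r, hr, hrU⟩ := Metric.isOpen_iff.1 hU x hx
  let χ : ContDiffBump x := ⟨r / 4, r / 2, by positivity, by linarith⟩
  let φ : En n → ℝ := fun y => χ y * ψ y
  have heq : φ =ᶠ[nhds x] ψ := by
    filter_upwards [χ.eventuallyEq_one] with y hy
    simp [φ, hy]
  have hφ : ContDiff ℝ 2 φ := by
    rw [contDiff_iff_contDiffAt]
    intro y
    by_cases hy : y ∈ U
    · exact (χ.contDiff.contDiffAt).mul (hψ.contDiffAt (hU.mem_nhds hy))
    · have hy' : y ∉ tsupport χ := by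
        rw [χ.tsupport_eq]
        intro h
        apply hy
        apply hrU
        have : dist y x ≤ r / 2 := h
        exact Metric.mem_ball.2 (by linarith)
      have h0 : φ =ᶠ[nhds y] fun _ => (0 : ℝ) := by
        filter_upwards [notMem_tsupport_iff_eventuallyEq.1 hy'] with z hz
        simp [φ, hz]
      exact contDiffAt_const.congr_of_eventuallyEq h0
  have hm' : IsLocalMax (u - φ) x := by
    refine hmax.congr ?_
    filter_upwards [heq] with y hy
    simp [hy]
  have key := husub φ hφ x hm'
  have h1 : gradient φ x = gradient ψ x := by
    unfold gradient
    rw [heq.fderiv_eq]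
  have h2 : hessianMatrix φ x = hessianMatrix ψ x := by
    unfold hessianMatrix
    ext i j
    rw [iteratedFDeriv_two_apply, iteratedFDeriv_two_apply, heq.fderiv.fderiv_eq]
  rwa [h1, h2] at key

/-- The blow-up barrier on the unit ball around `z`. -/
def barrier {n : ℕ} (A k : ℝ) (z : En n) (y : En n) : ℝ := A * (1 - ‖y - z‖ ^ 2) ^ (-k)

lemma hasFDerivAt_dpow {n : ℕ} (p : ℝ) (z y : En n) (hy : 0 < 1 - ‖y - z‖ ^ 2) :
    HasFDerivAt (fun y : En n => (1 - ‖y - z‖ ^ 2) ^ p)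
      ((-2 * p * (1 - ‖y - z‖ ^ 2) ^ (p - 1)) • innerSL ℝ (y - z)) y := by
  have h1 : HasFDerivAt (fun y : En n => 1 - ‖y - z‖ ^ 2) (-(2 • innerSL ℝ (y - z))) y := by
    have := (((hasFDerivAt_id y).sub_const z).norm_sq).const_sub 1
    simpa using this
  have h2 := (Real.hasDerivAt_rpow_const (p := p) (Or.inl hy.ne')).comp_hasFDerivAt y h1
  refine h2.congr_fderiv ?_
  ext v
  simp
  ring

lemma barrier_contDiffOn {n : ℕ} (A k : ℝ) (z : En n) :
    ContDiffOn ℝ 2 (barrier A k z) {y | 0 < 1 - ‖y - z‖ ^ 2} := by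
  intro y hy
  have hy' : 0 < 1 - ‖y - z‖ ^ 2 := hy
  refine ContDiffAt.contDiffWithinAt ?_
  unfold barrier
  refine contDiffAt_const.mul (ContDiffAt.rpow_const_of_ne ?_ hy'.ne')
  exact contDiffAt_const.sub ((contDiffAt_id.sub contDiffAt_const).norm_sq ℝ)

lemma isOpen_unit {n : ℕ} (z : En n) : IsOpen {y : En n | 0 < 1 - ‖y - z‖ ^ 2} :=
  isOpen_lt continuous_const (by fun_prop)

lemma barrier_fderiv {n : ℕ} (A k : ℝ) (z y : En n) (hy : 0 < 1 - ‖y - z‖ ^ 2) :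
    fderiv ℝ (barrier A k z) y =
      (2 * A * k * (1 - ‖y - z‖ ^ 2) ^ (-k - 1)) • innerSL ℝ (y - z) := by
  have h := (hasFDerivAt_dpow (-k) z y hy).const_mul A
  rw [show barrier A k z = fun y => A * (1 - ‖y - z‖ ^ 2) ^ (-k) from rfl, h.fderiv, smul_smul]
  congr 1
  ring

lemma barrier_gradient {n : ℕ} (A k : ℝ) (z y : En n) (hy : 0 < 1 - ‖y - z‖ ^ 2) :
    gradient (barrier A k z) y =
      (2 * A * k * (1 - ‖y - z‖ ^ 2) ^ (-k - 1)) • (y - z) := by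
  unfold gradient
  rw [barrier_fderiv A k z y hy]
  apply (InnerProductSpace.toDual ℝ (En n)).injective
  ext v
  simp

lemma barrier_hessian {n : ℕ} (A k : ℝ) (z y : En n) (hy : 0 < 1 - ‖y - z‖ ^ 2) :
    hessianMatrix (barrier A k z) y =
      (2 * A * k * (1 - ‖y - z‖ ^ 2) ^ (-k - 1)) • (1 : Matrix (Fin n) (Fin n) ℝ) +
      (4 * A * k * (k + 1) * (1 - ‖y - z‖ ^ 2) ^ (-k - 2)) •
        Matrix.vecMulVec (fun i => (y - z) i) (fun i => (y - z) i) := by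
  have heq : fderiv ℝ (barrier A k z) =ᶠ[nhds y] fun y =>
      (2 * A * k * (1 - ‖y - z‖ ^ 2) ^ (-k - 1)) • innerSL ℝ (y - z) := by
    filter_upwards [(isOpen_unit z).mem_nhds hy] with w hw
    exact barrier_fderiv A k z w hw
  have h1 := (hasFDerivAt_dpow (-k - 1) z y hy).const_mul (2 * A * k)
  have h2 : HasFDerivAt (fun y : En n => innerSL ℝ (y - z)) (innerSL ℝ) y :=
    (innerSL ℝ).hasFDerivAt.comp y ((hasFDerivAt_id y).sub_const z)
  have h3 := h1.smul h2
  ext i j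
  unfold hessianMatrix
  rw [iteratedFDeriv_two_apply, heq.fderiv_eq]
  erw [h3.fderiv]
  have e : -k - 1 - 1 = -k - 2 := by ring
  change (2 * A * k * (1 - ‖y - z‖ ^ 2) ^ (-k - 1)) *
      inner ℝ (EuclideanSpace.single i (1 : ℝ)) (EuclideanSpace.single j (1 : ℝ)) +
    ((2 * A * k) * ((-2 * (-k - 1) * (1 - ‖y - z‖ ^ 2) ^ (-k - 1 - 1)) *
      inner ℝ (y - z) (EuclideanSpace.single i (1 : ℝ)))) *
      inner ℝ (y - z) (EuclideanSpace.single j (1 : ℝ)) = _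
  have hij : inner ℝ (EuclideanSpace.single i (1 : ℝ)) (EuclideanSpace.single j (1 : ℝ))
      = if i = j then (1 : ℝ) else 0 := by
    simp [EuclideanSpace.inner_single_left]
  rw [hij]
  simp [Matrix.vecMulVec_apply, Matrix.one_apply, e, EuclideanSpace.inner_single_right]
  ring

/-- The barrier is a strict supersolution. -/
lemma barrier_super {n : ℕ} {lam Lam m s γ₁ γm k A : ℝ}
    {F : En n → Matrix (Fin n) (Fin n) ℝ → ℝ} {H : En n → En n → ℝ}
    (hLam : 0 ≤ Lam) (hm1 : 1 ≤ m) (hsm : m < s)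
    (hFell : ∀ (x : En n) (X Y : Matrix (Fin n) (Fin n) ℝ), X.IsSymm → Y.IsSymm →
      Y.PosSemidef →
      lam * Y.trace ≤ F x (X + Y) - F x X ∧ F x (X + Y) - F x X ≤ Lam * Y.trace)
    (hF0 : ∀ x, F x 0 = 0) (hH0 : ∀ x, H x 0 = 0)
    (hγ₁ : 0 < γ₁) (hγm : 0 < γm)
    (hHlip : ∀ x p q : En n,
      |H x p - H x q| ≤ (γ₁ + γm * (‖p‖ ^ (m - 1) + ‖q‖ ^ (m - 1))) * ‖p - q‖)
    (hk1 : 1 ≤ k) (hk2 : k + 2 ≤ k * s) (hk3 : m * (k + 1) ≤ k * s) (hA1 : 1 ≤ A)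
    (hA : Lam * (2 * k * n + 4 * k * (k + 1)) + (γ₁ + γm) * (2 * k) + γm * (2 * k) ^ m
      < A ^ (s - m))
    (z y : En n) (hy : 0 < 1 - ‖y - z‖ ^ 2) :
    F y (hessianMatrix (barrier A k z) y) + H y (gradient (barrier A k z) y)
      < barrier A k z y ^ s := by
  set d := 1 - ‖y - z‖ ^ 2 with hd
  have hd1 : d ≤ 1 := by rw [hd]; nlinarith [sq_nonneg ‖y - z‖]
  have hk0 : 0 < k := by linarith
  have hA0 : 0 < A := by linarith
  have hz2 : ‖y - z‖ ^ 2 ≤ 1 := by linarith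
  have hz1 : ‖y - z‖ ≤ 1 := by nlinarith [norm_nonneg (y - z)]
  set T := d ^ (-(k * s)) with hT
  have hT0 : 0 < T := rpow_pos_of_pos hy _
  have mono : ∀ p : ℝ, -(k * s) ≤ p → d ^ p ≤ T := fun p hp =>
    rpow_le_rpow_of_exponent_ge hy hd1 hp
  have hb1 : d ^ (-k - 1) ≤ T := mono _ (by linarith)
  have hb2 : d ^ (-k - 2) ≤ T := mono _ (by linarith)
  have hb10 : 0 < d ^ (-k - 1) := rpow_pos_of_pos hy _
  have hb20 : 0 < d ^ (-k - 2) := rpow_pos_of_pos hy _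
  have hAm : A ≤ A ^ m := by
    simpa using rpow_le_rpow_of_exponent_le hA1 hm1
  have hAm0 : 0 < A ^ m := rpow_pos_of_pos hA0 _
  -- second order part
  have hFb : F y (hessianMatrix (barrier A k z) y) ≤
      Lam * (2 * k * n + 4 * k * (k + 1)) * (A ^ m * T) := by
    rw [barrier_hessian A k z y hy]
    set a := 2 * A * k * (1 - ‖y - z‖ ^ 2) ^ (-k - 1) with ha
    set b := 4 * A * k * (k + 1) * (1 - ‖y - z‖ ^ 2) ^ (-k - 2) with hb
    set v : Fin n → ℝ := fun i => (y - z) i with hv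
    have ha0 : 0 ≤ a := by rw [ha, ← hd]; positivity
    have hb0 : 0 ≤ b := by rw [hb, ← hd]; positivity
    have hpsd : (a • (1 : Matrix (Fin n) (Fin n) ℝ) + b • Matrix.vecMulVec v v).PosSemidef := by
      refine (Matrix.PosSemidef.one.smul ha0).add (Matrix.PosSemidef.smul ?_ hb0)
      simpa using Matrix.posSemidef_vecMulVec_self_star v
    have hsymm : (a • (1 : Matrix (Fin n) (Fin n) ℝ) + b • Matrix.vecMulVec v v).IsSymm := by
      have := hpsd.isHermitian
      rw [Matrix.IsHermitian, Matrix.conjTranspose_eq_transpose_of_trivial] at this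
      exact this
    have h := (hFell y 0 _ Matrix.isSymm_zero hsymm hpsd).2
    rw [zero_add, hF0, sub_zero] at h
    have hv2 : Matrix.trace (Matrix.vecMulVec v v) = ‖y - z‖ ^ 2 := by
      rw [EuclideanSpace.norm_sq_eq, Matrix.trace_vecMulVec]
      simp [dotProduct, hv, sq]
    have htr : Matrix.trace (a • (1 : Matrix (Fin n) (Fin n) ℝ) + b • Matrix.vecMulVec v v)
        = a * n + b * ‖y - z‖ ^ 2 := by
      rw [Matrix.trace_add, Matrix.trace_smul, Matrix.trace_smul, hv2]
      simp
    rw [htr] at h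
    refine h.trans ?_
    rw [mul_assoc Lam]
    refine mul_le_mul_of_nonneg_left ?_ hLam
    have hAT1 : A * d ^ (-k - 1) ≤ A ^ m * T := by gcongr
    have hAT2 : A * d ^ (-k - 2) ≤ A ^ m * T := by gcongr
    calc a * n + b * ‖y - z‖ ^ 2 ≤ a * n + b * 1 := by gcongr
      _ = 2 * k * n * (A * d ^ (-k - 1)) + 4 * k * (k + 1) * (A * d ^ (-k - 2)) := by
        rw [ha, hb, ← hd]; ring
      _ ≤ 2 * k * n * (A ^ m * T) + 4 * k * (k + 1) * (A ^ m * T) := by gcongr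
      _ = _ := by ring
  -- first order part
  have hHb : H y (gradient (barrier A k z) y) ≤
      ((γ₁ + γm) * (2 * k) + γm * (2 * k) ^ m) * (A ^ m * T) := by
    rw [barrier_gradient A k z y hy, ← hd]
    set p : En n := (2 * A * k * d ^ (-k - 1)) • (y - z) with hp
    have hpn : ‖p‖ ≤ 2 * k * A * d ^ (-k - 1) := by
      rw [hp, norm_smul, Real.norm_of_nonneg (by positivity)]
      calc 2 * A * k * d ^ (-k - 1) * ‖y - z‖ ≤ 2 * A * k * d ^ (-k - 1) * 1 := by gcongr
        _ = _ := by ring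
    have h := le_of_abs_le (hHlip y p 0)
    rw [hH0, sub_zero, sub_zero, norm_zero] at h
    have h01 : (0 : ℝ) ^ (m - 1) ≤ 1 := by
      rcases eq_or_lt_of_le hm1 with h | h
      · rw [← h]; simp
      · rw [zero_rpow (by linarith)]; norm_num
    have hpm : ‖p‖ ^ (m - 1) * ‖p‖ = ‖p‖ ^ m := by
      rcases eq_or_lt_of_le (norm_nonneg p) with h | h
      · rw [← h, mul_zero, zero_rpow (by linarith)]
      · rw [← rpow_add_one h.ne']; congr 1; ring
    have hAT1 : A * d ^ (-k - 1) ≤ A ^ m * T := by gcongr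
    have hpmb : ‖p‖ ^ m ≤ (2 * k) ^ m * (A ^ m * T) := by
      calc ‖p‖ ^ m ≤ (2 * k * A * d ^ (-k - 1)) ^ m := by gcongr
        _ = (2 * k) ^ m * (A ^ m * d ^ ((-k - 1) * m)) := by
          rw [mul_rpow (by positivity) hb10.le, mul_rpow (by positivity) hA0.le,
            ← rpow_mul hy.le, mul_assoc]
        _ ≤ _ := by
          have := mono ((-k - 1) * m) (by linarith)
          gcongr
    calc H y p ≤ (γ₁ + γm * (‖p‖ ^ (m - 1) + 0 ^ (m - 1))) * ‖p‖ := h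
      _ ≤ (γ₁ + γm * (‖p‖ ^ (m - 1) + 1)) * ‖p‖ := by gcongr
      _ = (γ₁ + γm) * ‖p‖ + γm * ‖p‖ ^ m := by rw [← hpm]; ring
      _ ≤ (γ₁ + γm) * (2 * k * (A * d ^ (-k - 1))) + γm * ((2 * k) ^ m * (A ^ m * T)) := by
        have : ‖p‖ ≤ 2 * k * (A * d ^ (-k - 1)) := by rw [← mul_assoc]; exact hpn
        gcongr
      _ ≤ (γ₁ + γm) * (2 * k * (A ^ m * T)) + γm * ((2 * k) ^ m * (A ^ m * T)) := by gcongr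
      _ = _ := by ring
  have hs : barrier A k z y ^ s = A ^ (s - m) * (A ^ m * T) := by
    unfold barrier
    rw [← hd, mul_rpow hA0.le (by positivity), ← rpow_mul hy.le, ← mul_assoc,
      ← rpow_add hA0, hT]
    congr 2 <;> ring
  rw [hs]
  have hpos : 0 < A ^ m * T := by positivity
  have := mul_lt_mul_of_pos_right hA hpos
  linarith

/-- Local bound. -/
lemma local_bound {n : ℕ} {s k A K : ℝ}
    {F : En n → Matrix (Fin n) (Fin n) ℝ → ℝ} {H : En n → En n → ℝ} {f u : En n → ℝ}
    (hs : 1 < s) (hk1 : 1 ≤ k) (hA1 : 1 ≤ A) (hK : 0 ≤ K) (z : En n)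
    (hsup : ∀ y : En n, 0 < 1 - ‖y - z‖ ^ 2 →
      F y (hessianMatrix (barrier A k z) y) + H y (gradient (barrier A k z) y)
        < barrier A k z y ^ s)
    (hfK : ∀ y : En n, ‖y - z‖ ≤ 1 → -f y ≤ K ^ s)
    (hu : Continuous u) (husub : ViscositySubsolution F H s f u) :
    u z ≤ K + A := by
  by_contra hcon
  push Not at hcon
  have hbz : barrier A k z z = A := by simp [barrier]
  obtain ⟨M, hM⟩ := (isCompact_closedBall z 1).bddAbove_image hu.continuousOn
  have hM' : ∀ y, ‖y - z‖ ≤ 1 → u y ≤ M := fun y hy =>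
    hM ⟨y, by simpa [dist_eq_norm] using hy, rfl⟩
  set t : ℝ := 1 / (|M| + 2) with ht
  have ht0 : 0 < t := by positivity
  have ht1 : t < 1 := by
    rw [ht, div_lt_one (by positivity)]; linarith [abs_nonneg M]
  set r := √(1 - t) with hr
  have hr2 : r ^ 2 = 1 - t := sq_sqrt (by linarith)
  have hr0 : 0 < r := sqrt_pos.2 (by linarith)
  have hr1 : r < 1 := by nlinarith
  have hin : ∀ y ∈ Metric.closedBall z r, 0 < 1 - ‖y - z‖ ^ 2 := by
    intro y hy
    have h : ‖y - z‖ ≤ r := by simpa [dist_eq_norm] using hy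
    nlinarith [norm_nonneg (y - z)]
  have hcont : ContinuousOn (u - barrier A k z) (Metric.closedBall z r) :=
    hu.continuousOn.sub ((barrier_contDiffOn A k z).continuousOn.mono hin)
  obtain ⟨x, hx, hmax⟩ := (isCompact_closedBall z r).exists_isMaxOn
    ⟨z, Metric.mem_closedBall_self hr0.le⟩ hcont
  have hge : u z - A ≤ u x - barrier A k z x := by
    have := hmax (Metric.mem_closedBall_self hr0.le)
    simpa [hbz] using this
  have hxr : ‖x - z‖ ≤ r := by simpa [dist_eq_norm] using hx
  have hlt : ‖x - z‖ < r := by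
    rcases eq_or_lt_of_le hxr with h | h
    · exfalso
      have h1 : barrier A k z x = A * t ^ (-k) := by
        unfold barrier; rw [h, hr2]; congr 2; ring
      have h2 : t ^ (-1 : ℝ) ≤ t ^ (-k) :=
        rpow_le_rpow_of_exponent_ge ht0 ht1.le (by linarith)
      rw [rpow_neg_one, ht, one_div, inv_inv, ← one_div, ← ht] at h2
      have h3 := hM' x (by linarith)
      have h4 := le_abs_self M
      have h5 : |M| + 2 ≤ A * t ^ (-k) := by nlinarith [abs_nonneg M]
      linarith
    · exact h
  have hdx := hin x hx
  have hloc : IsLocalMax (u - barrier A k z) x := by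
    refine hmax.isLocalMax ?_
    refine Filter.mem_of_superset (Metric.isOpen_ball.mem_nhds ?_) Metric.ball_subset_closedBall
    simpa [dist_eq_norm] using hlt
  have key := test_local husub (isOpen_unit z) (barrier_contDiffOn A k z) hdx hloc
  have h1 := hsup x hdx
  have h2 := hfK x (by linarith)
  have hb0 : 0 ≤ barrier A k z x := by
    unfold barrier
    have := rpow_pos_of_pos hdx (-k)
    positivity
  have hux : K + barrier A k z x < u x := by linarith
  have hu0 : 0 < u x := by linarith
  have h3 : |u x| ^ (s - 1) * u x = u x ^ s := by
    rw [abs_of_pos hu0, ← rpow_add_one hu0.ne']; congr 1; ring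
  rw [h3] at key
  have h4 : K ^ s + barrier A k z x ^ s ≤ (K + barrier A k z x) ^ s :=
    add_rpow_le_rpow_add hK hb0 hs.le
  have h5 : (K + barrier A k z x) ^ s < u x ^ s :=
    rpow_lt_rpow (by linarith) hux (by linarith)
  linarith

theorem growth_of_subsolutions
    (n : ℕ) (hn : 1 ≤ n) (lam Lam m s ρ μ γ₁ γm : ℝ)
    (F : En n → Matrix (Fin n) (Fin n) ℝ → ℝ)
    (H : En n → En n → ℝ) (f u : En n → ℝ)
    (hlam : 0 < lam) (hlamLam : lam ≤ Lam)
    (hm1 : 1 ≤ m) (hm2 : m ≤ 2) (hsm : m < s)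
    (hμ : μ = if m ≤ 2 * s / (s + 1) then 2 / (s - 1) else m / (s - m))
    (hFell : ∀ (x : En n) (X Y : Matrix (Fin n) (Fin n) ℝ), X.IsSymm → Y.IsSymm →
      Y.PosSemidef →
      lam * Y.trace ≤ F x (X + Y) - F x X ∧ F x (X + Y) - F x X ≤ Lam * Y.trace)
    (hF0 : ∀ x, F x 0 = 0)
    (hFcont : ∀ X : Matrix (Fin n) (Fin n) ℝ, X.IsSymm → Continuous fun x => F x X)
    (hHcont : Continuous fun xp : En n × En n => H xp.1 xp.2)
    (hH0 : ∀ x, H x 0 = 0)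
    (hγ₁ : 0 < γ₁) (hγm : 0 < γm)
    (hHlip : ∀ x p q : En n,
      |H x p - H x q| ≤ (γ₁ + γm * (‖p‖ ^ (m - 1) + ‖q‖ ^ (m - 1))) * ‖p - q‖)
    (hf : Continuous f) (hρ : 0 ≤ ρ)
    (hflimsup : ∃ C M : ℝ, ∀ x : En n, M ≤ ‖x‖ → max (-f x) 0 ≤ C * ‖x‖ ^ ρ)
    (hu : Continuous u) (husub : ViscositySubsolution F H s f u) :
    ∃ C M : ℝ, ∀ x : En n, M ≤ ‖x‖ →
      (max (u x) 0) ^ s ≤ C * ‖x‖ ^ (μ * s * ρ / 2) := by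
  obtain ⟨C, M, hCM⟩ := hflimsup
  have hs : 1 < s := by linarith
  set k : ℝ := max 1 (max (2 / (s - 1)) (m / (s - m))) with hk
  have hk1 : 1 ≤ k := le_max_left _ _
  have hka : 2 / (s - 1) ≤ k := (le_max_left _ _).trans (le_max_right _ _)
  have hkb : m / (s - m) ≤ k := (le_max_right _ _).trans (le_max_right _ _)
  rw [div_le_iff₀ (by linarith)] at hka hkb
  have hk2 : k + 2 ≤ k * s := by linarith
  have hk3 : m * (k + 1) ≤ k * s := by linarith
  obtain ⟨A, hA1, hA⟩ : ∃ A : ℝ, 1 ≤ A ∧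
      Lam * (2 * k * n + 4 * k * (k + 1)) + (γ₁ + γm) * (2 * k) + γm * (2 * k) ^ m
        < A ^ (s - m) :=
    ((Filter.eventually_ge_atTop 1).and
      ((tendsto_rpow_atTop (by linarith : 0 < s - m)).eventually_gt_atTop _)).exists
  have hμs : 1 ≤ μ * s / 2 := by
    have h1 : 2 / (s - 1) ≤ μ := by
      rw [hμ]
      split_ifs with h
      · exact le_rfl
      · rw [not_le, div_lt_iff₀ (by linarith)] at h
        rw [div_le_div_iff₀ (by linarith) (by linarith)]
        linarith
    rw [div_le_iff₀ (by linarith)] at h1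
    have h2 : 0 < μ := by
      by_contra hneg
      push Not at hneg
      nlinarith
    linarith
  set D : ℝ := |C| * 2 ^ ρ with hD
  have hD0 : 0 ≤ D := by positivity
  refine ⟨2 ^ s * (D + A ^ s), max 1 (M + 1), fun x hx => ?_⟩
  have hx1 : 1 ≤ ‖x‖ := (le_max_left _ _).trans hx
  have hxM : M + 1 ≤ ‖x‖ := (le_max_right _ _).trans hx
  have hxρ : 1 ≤ ‖x‖ ^ ρ := one_le_rpow hx1 hρ
  set K : ℝ := (D * ‖x‖ ^ ρ) ^ (1 / s) with hK
  have hK0 : 0 ≤ K := by positivity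
  have hA0 : 0 ≤ A := by linarith
  have hKs : K ^ s = D * ‖x‖ ^ ρ := by
    rw [hK, ← rpow_mul (by positivity), one_div_mul_cancel (by linarith), rpow_one]
  have hfK : ∀ y : En n, ‖y - x‖ ≤ 1 → -f y ≤ K ^ s := by
    intro y hy
    have h1 : ‖x‖ - ‖y‖ ≤ ‖y - x‖ := by
      rw [norm_sub_rev]; exact norm_sub_norm_le x y
    have h2 : ‖y‖ - ‖x‖ ≤ ‖y - x‖ := norm_sub_norm_le y x
    have h3 := (le_max_left _ _).trans (hCM y (by linarith))
    calc -f y ≤ C * ‖y‖ ^ ρ := h3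
      _ ≤ |C| * (2 * ‖x‖) ^ ρ := by
        have : ‖y‖ ≤ 2 * ‖x‖ := by linarith
        have h5 := le_abs_self C
        gcongr
      _ = K ^ s := by rw [hKs, hD, mul_rpow (by norm_num) (by positivity), mul_assoc]
  have hb : u x ≤ K + A := local_bound hs hk1 hA1 hK0 x
    (fun y hy => barrier_super (by linarith) hm1 hsm hFell hF0 hH0 hγ₁ hγm hHlip hk1 hk2 hk3
      hA1 hA x y hy) hfK hu husub
  have hb2 : max (u x) 0 ≤ 2 * max K A := by
    have := le_max_left K A
    have := le_max_right K A
    exact max_le (by linarith) (by linarith)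
  have hmx : (max K A) ^ s ≤ K ^ s + A ^ s := by
    have h1 : 0 ≤ K ^ s := by positivity
    have h2 : 0 ≤ A ^ s := by positivity
    rcases max_choice K A with h | h <;> rw [h] <;> linarith
  have hmx0 : 0 ≤ max K A := le_max_of_le_left hK0
  calc (max (u x) 0) ^ s ≤ (2 * max K A) ^ s := by
        exact rpow_le_rpow (le_max_right _ _) hb2 (by linarith)
    _ = 2 ^ s * (max K A) ^ s := mul_rpow (by norm_num) hmx0
    _ ≤ 2 ^ s * (D * ‖x‖ ^ ρ + A ^ s * ‖x‖ ^ ρ) := by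
        rw [hKs] at hmx
        have : A ^ s ≤ A ^ s * ‖x‖ ^ ρ := le_mul_of_one_le_right (by positivity) hxρ
        have h2 : (max K A) ^ s ≤ D * ‖x‖ ^ ρ + A ^ s * ‖x‖ ^ ρ := by linarith
        gcongr
    _ = 2 ^ s * (D + A ^ s) * ‖x‖ ^ ρ := by ring
    _ ≤ 2 ^ s * (D + A ^ s) * ‖x‖ ^ (μ * s * ρ / 2) := by
        have : ρ ≤ μ * s * ρ / 2 := by nlinarith
        gcongr
end
end

section
/- Let n ≥ 1, 0 < λ ≤ Λ, m ∈ [1,2] and s > m, and set μ = 2/(s−1) if 1 ≤ m ≤ 2s/(s+1) and μ = m/(s−m) if 2s/(s+1) < m. Let F : ℝⁿ × Sⁿ → ℝ (Sⁿ the symmetric n×n real matrices) satisfy λ·Tr(Y) ≤ F(x,X+Y) − F(x,X) ≤ Λ·Tr(Y) for all x, all X ∈ Sⁿ and all positive semidefinite Y ∈ Sⁿ, F(x,0) = 0, and x ↦ F(x,X) continuous for each X. Let H : ℝⁿ × ℝⁿ → ℝ be continuous with H(x,0) = 0 and satisfy, for some constants γ₁, γ_m > 0, |H(x,p) − H(x,q)|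 ≤ (γ₁ + γ_m(|p|^{m−1} + |q|^{m−1}))|p−q| for all p, q, x ∈ ℝⁿ. Let f : ℝⁿ → ℝ be continuous, let ρ ≥ 0 and suppose limsup_{|x|→∞} f⁺(x)/|x|^ρ < ∞. Then every continuous viscosity supersolution u of F(x,D²u) + H(x,Du) − |u|^{s−1}u = f(x) in ℝⁿ satisfies limsup_{|x|→∞} (u⁻(x))^s / |x|^{μsρ/2} < ∞. -/
noncomputable section
open Real

lemma aux_taylor (N : ℕ) : ∃ C : ℝ, 0 ≤ C ∧ ∀ τ : ℝ, |τ| ≤ 1/2 →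
    ((1 - τ)⁻¹) ^ N ≤ 1 + N * τ + C * τ ^ 2 := by
  induction N with
  | zero => exact ⟨0, le_rfl, fun τ _ => by simp⟩
  | succ N ih =>
    obtain ⟨C, hC, h⟩ := ih
    refine ⟨N + C + C + 2 * (1 + N + C), by positivity, fun τ hτ => ?_⟩
    have h1 := h τ hτ
    obtain ⟨ha, hb⟩ := abs_le.1 hτ
    have hpos : 0 < 1 - τ := by linarith
    have hN : (0:ℝ) ≤ N := Nat.cast_nonneg N
    have hq : 0 < (1 - τ)⁻¹ := inv_pos.2 hpos
    have hq2 : (1 - τ)⁻¹ ≤ 2 := by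
      rw [inv_le_comm₀ hpos (by norm_num)]; linarith
    have hid : (1 - τ)⁻¹ = 1 + τ + τ ^ 2 * (1 - τ)⁻¹ := by
      field_simp; ring
    have e1 : (1 + N * τ + C * τ ^ 2) * (1 - τ)⁻¹ ≤ 2 * (1 + N + C) := by
      have : (1 + N * τ + C * τ ^ 2) ≤ 1 + N + C := by
        have : τ ^ 2 ≤ 1 := by nlinarith
        nlinarith
      calc _ ≤ (1 + N + C) * (1 - τ)⁻¹ := by gcongr
        _ ≤ (1 + N + C) * 2 := by gcongr
        _ = _ := by ring
    calc ((1 - τ)⁻¹) ^ (N+1) = ((1 - τ)⁻¹) ^ N * (1 - τ)⁻¹ := pow_succ _ _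
      _ ≤ (1 + N * τ + C * τ ^ 2) * (1 - τ)⁻¹ := by gcongr
      _ = (1 + N * τ + C * τ ^ 2) * (1 + τ) +
          τ ^ 2 * ((1 + N * τ + C * τ ^ 2) * (1 - τ)⁻¹) := by
        conv_lhs => rw [hid]
        ring
      _ ≤ (1 + N * τ + C * τ ^ 2) * (1 + τ) + τ ^ 2 * (2 * (1 + N + C)) := by gcongr
      _ ≤ _ := by
        push_cast
        have : τ ^ 2 * (C * τ) ≤ τ ^ 2 * C := by
          gcongr; nlinarith
        nlinarith

def quadT {n : ℕ} (x₁ b : En n) (a c : ℝ) : En n → ℝ :=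
  fun x => a + inner ℝ b (x - x₁) - c * ‖x - x₁‖ ^ 2

lemma quadT_contDiff {n : ℕ} (x₁ b : En n) (a c : ℝ) : ContDiff ℝ 2 (quadT x₁ b a c) := by
  unfold quadT
  have h1 : ContDiff ℝ 2 (fun x : En n => ‖x - x₁‖ ^ 2) :=
    (contDiff_id.sub contDiff_const).norm_sq ℝ
  have h2 : ContDiff ℝ 2 (fun x : En n => inner ℝ b (x - x₁)) :=
    ContDiff.inner ℝ contDiff_const (contDiff_id.sub contDiff_const)
  exact (contDiff_const.add h2).sub (contDiff_const.mul h1)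

lemma quadT_fderiv {n : ℕ} (x₁ b : En n) (a c : ℝ) (x : En n) :
    HasFDerivAt (quadT x₁ b a c) (innerSL ℝ b - (2 * c) • innerSL ℝ (x - x₁)) x := by
  unfold quadT
  have h0 : HasFDerivAt (fun x : En n => x - x₁) (ContinuousLinearMap.id ℝ (En n)) x :=
    (hasFDerivAt_id x).sub_const x₁
  have h1 := h0.norm_sq
  have h2 : HasFDerivAt (fun x : En n => inner ℝ b (x - x₁))
      ((innerSL ℝ b).comp (ContinuousLinearMap.id ℝ (En n))) x :=
    (innerSL ℝ b).hasFDerivAt.comp x h0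
  have h3 := (h2.const_add a).sub (h1.const_mul c)
  refine h3.congr_fderiv ?_
  ext v
  simp
  ring

lemma quadT_grad {n : ℕ} (x₁ b : En n) (a c : ℝ) : gradient (quadT x₁ b a c) x₁ = b := by
  apply HasGradientAt.gradient
  rw [hasGradientAt_iff_hasFDerivAt]
  refine (quadT_fderiv x₁ b a c x₁).congr_fderiv ?_
  ext v
  simp

lemma quadT_hess {n : ℕ} (x₁ b : En n) (a c : ℝ) :
    hessianMatrix (quadT x₁ b a c) x₁ = -((2 * c) • (1 : Matrix (Fin n) (Fin n) ℝ)) := by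
  ext i j
  unfold hessianMatrix
  rw [iteratedFDeriv_two_apply]
  have e : fderiv ℝ (quadT x₁ b a c) =
      fun x => innerSL ℝ b - (2 * c) • innerSL ℝ (x - x₁) := by
    funext x; exact (quadT_fderiv x₁ b a c x).fderiv
  rw [e]
  have h0 : HasFDerivAt (fun x : En n => x - x₁) (ContinuousLinearMap.id ℝ (En n)) x₁ :=
    (hasFDerivAt_id x₁).sub_const x₁
  have h2 : HasFDerivAt (fun x : En n => innerSL ℝ (x - x₁))
      ((innerSL ℝ).comp (ContinuousLinearMap.id ℝ (En n))) x₁ :=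
    (innerSL (E := En n) ℝ).hasFDerivAt.comp x₁ h0
  have h3 := (h2.const_smul (2 * c)).const_sub (innerSL ℝ b)
  have e3 := h3.fderiv
  simp only [Pi.smul_apply] at e3
  rw [e3]
  simp [Matrix.one_apply]
  rw [innerSL_apply_apply, EuclideanSpace.inner_single_left]
  by_cases hij : i = j <;> simp [hij, PiLp.single_apply]

lemma F_lower {n : ℕ} (lam Lam : ℝ) (F : En n → Matrix (Fin n) (Fin n) ℝ → ℝ)
    (hFell : ∀ (x : En n) (X Y : Matrix (Fin n) (Fin n) ℝ), X.IsSymm → Y.IsSymm →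
      Y.PosSemidef →
      lam * Y.trace ≤ F x (X + Y) - F x X ∧ F x (X + Y) - F x X ≤ Lam * Y.trace)
    (hF0 : ∀ x, F x 0 = 0) (x : En n) (c : ℝ) (hc : 0 ≤ c) :
    -(Lam * (c * n)) ≤ F x (-(c • (1 : Matrix (Fin n) (Fin n) ℝ))) := by
  have hs : (c • (1 : Matrix (Fin n) (Fin n) ℝ)).IsSymm := Matrix.isSymm_one.smul c
  have h := (hFell x (-(c • (1 : Matrix (Fin n) (Fin n) ℝ))) (c • 1) hs.neg hs
    (Matrix.PosSemidef.one.smul hc)).2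
  rw [neg_add_cancel, hF0, Matrix.trace_smul, Matrix.trace_one] at h
  simp at h
  linarith

lemma H_lower {n : ℕ} (m γ₁ γm : ℝ) (H : En n → En n → ℝ) (hm1 : 1 ≤ m)
    (hH0 : ∀ x, H x 0 = 0) (hγ₁ : 0 < γ₁) (hγm : 0 < γm)
    (hHlip : ∀ x p q : En n,
      |H x p - H x q| ≤ (γ₁ + γm * (‖p‖ ^ (m - 1) + ‖q‖ ^ (m - 1))) * ‖p - q‖)
    (x p : En n) (P : ℝ) (hP : 1 ≤ P) (hp : ‖p‖ ≤ P) :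
    -((γ₁ + 2 * γm) * P ^ m) ≤ H x p := by
  have h := hHlip x p 0
  rw [hH0, sub_zero, sub_zero] at h
  have h0 : ‖(0 : En n)‖ ^ (m - 1) ≤ P ^ (m - 1) :=
    Real.rpow_le_rpow (norm_nonneg _) (by simp; linarith) (by linarith)
  have h1 : ‖p‖ ^ (m - 1) ≤ P ^ (m - 1) :=
    Real.rpow_le_rpow (norm_nonneg _) hp (by linarith)
  have h2 : 1 ≤ P ^ (m - 1) := Real.one_le_rpow hP (by linarith)
  have e : P ^ m = P ^ (m - 1) * P := by
    rw [← Real.rpow_add_one (by linarith)]; ring_nf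
  have : |H x p| ≤ (γ₁ + 2 * γm) * P ^ m := by
    calc |H x p| ≤ _ := h
      _ ≤ (γ₁ * P ^ (m-1) + γm * (P ^ (m-1) + P ^ (m-1))) * P := by
        gcongr
        nlinarith
      _ = _ := by rw [e]; ring
  linarith [neg_abs_le (H x p)]

lemma barrier_touch {n : ℕ} (N : ℕ) (C K A : ℝ) (hC : 0 ≤ C) (hK : 0 ≤ K)
    (hT : ∀ τ : ℝ, |τ| ≤ 1/2 → ((1 - τ)⁻¹) ^ N ≤ 1 + N * τ + C * τ ^ 2)
    (u : En n → ℝ) (x₀ x₁ : En n) (t : ℝ) (hx : ‖x₁ - x₀‖ ^ 2 < 1)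
    (ht : t = (1 - ‖x₁ - x₀‖ ^ 2)⁻¹)
    (hmin : IsLocalMin (fun x => u x + (A + K * ((1 - ‖x - x₀‖ ^ 2)⁻¹) ^ N)) x₁) :
    IsLocalMin (u - quadT x₁ (-((2 * K * N * t ^ (N + 1)) • (x₁ - x₀))) (-(A + K * t ^ N))
      (K * (N + 9 * C) * t ^ (N + 2))) x₁ := by
  have hD : 0 < 1 - ‖x₁ - x₀‖ ^ 2 := by linarith
  have ht1 : 1 ≤ t := by
    rw [ht, one_le_inv₀ hD]; nlinarith [sq_nonneg ‖x₁ - x₀‖]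
  have hevent : ∀ᶠ x in nhds x₁, ‖x - x₁‖ ≤ 1 / (6 * t) := by
    have : Filter.Tendsto (fun x : En n => ‖x - x₁‖) (nhds x₁) (nhds 0) := by
      have : Continuous (fun x : En n => ‖x - x₁‖) := by fun_prop
      simpa using this.tendsto x₁
    exact (this.eventually (gt_mem_nhds (by positivity : 0 < 1 / (6 * t)))).mono
      fun x hx => le_of_lt hx
  filter_upwards [hmin, hevent] with x hm hz
  simp only [Pi.sub_apply, quadT, sub_self, inner_zero_right, norm_zero]
  rw [← ht] at hm
  set z := x - x₁ with hzdef
  set y := x₁ - x₀ with hy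
  have hxy : x - x₀ = y + z := by rw [hzdef, hy]; abel
  have hns : ‖x - x₀‖ ^ 2 = ‖y‖ ^ 2 + 2 * inner ℝ y z + ‖z‖ ^ 2 := by
    rw [hxy]; exact norm_add_sq_real y z
  have hy1 : ‖y‖ ≤ 1 := by nlinarith [norm_nonneg y]
  have hz0 := norm_nonneg z
  have hyz : |inner ℝ y z| ≤ ‖z‖ :=
    (abs_real_inner_le_norm y z).trans (by nlinarith)
  have hz1 : ‖z‖ * t ≤ 1 / 6 := by
    calc ‖z‖ * t ≤ 1 / (6 * t) * t := by gcongr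
      _ = 1 / 6 := by field_simp
  have hz2 : ‖z‖ ≤ 1 := by nlinarith
  set h := 2 * inner ℝ y z + ‖z‖ ^ 2 with hh
  have hhabs : |h| ≤ 3 * ‖z‖ := by
    rw [abs_le] at hyz ⊢
    constructor <;> nlinarith [hyz.1, hyz.2]
  have hτ : |h * t| ≤ 1 / 2 := by
    rw [abs_mul, abs_of_pos (by linarith : 0 < t)]
    nlinarith
  have hkey := hT (h * t) hτ
  have hτ' := abs_le.1 hτ
  have hinv : (1 - ‖x - x₀‖ ^ 2)⁻¹ = t * (1 - h * t)⁻¹ := by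
    have : 1 - ‖x - x₀‖ ^ 2 = t⁻¹ * (1 - h * t) := by
      rw [hns, ht, inv_inv]
      field_simp
      ring
    rw [this, mul_inv, inv_inv]
  rw [hinv, mul_pow] at hm
  have hsq : h ^ 2 ≤ 9 * ‖z‖ ^ 2 := by
    rw [← sq_abs h]; nlinarith [abs_nonneg h]
  have hb : t ^ N * ((1 - h * t)⁻¹) ^ N ≤
      t ^ N + N * t ^ (N+1) * (2 * inner ℝ y z) + (N + 9 * C) * t ^ (N+2) * ‖z‖ ^ 2 := by
    calc t ^ N * ((1 - h * t)⁻¹) ^ N ≤ t ^ N * (1 + N * (h * t) + C * (h * t) ^ 2) := by gcongr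
      _ = t ^ N + N * t ^ (N+1) * (2 * inner ℝ y z) + N * t ^ (N+1) * ‖z‖ ^ 2
          + C * t ^ (N+2) * h ^ 2 := by rw [hh]; ring
      _ ≤ t ^ N + N * t ^ (N+1) * (2 * inner ℝ y z) + N * t ^ (N+2) * ‖z‖ ^ 2
          + C * t ^ (N+2) * (9 * ‖z‖ ^ 2) := by
        gcongr
        norm_num
      _ = _ := by ring
  have hb2 := mul_le_mul_of_nonneg_left hb hK
  rw [inner_neg_left, real_inner_smul_left]
  nlinarith

set_option maxHeartbeats 1000000 in
lemma local_est {n : ℕ} (lam Lam m s γ₁ γm : ℝ)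
    (F : En n → Matrix (Fin n) (Fin n) ℝ → ℝ)
    (H : En n → En n → ℝ) (f u : En n → ℝ)
    (hlam : 0 < lam) (hlamLam : lam ≤ Lam)
    (hm1 : 1 ≤ m) (hsm : m < s)
    (hFell : ∀ (x : En n) (X Y : Matrix (Fin n) (Fin n) ℝ), X.IsSymm → Y.IsSymm →
      Y.PosSemidef →
      lam * Y.trace ≤ F x (X + Y) - F x X ∧ F x (X + Y) - F x X ≤ Lam * Y.trace)
    (hF0 : ∀ x, F x 0 = 0)
    (hH0 : ∀ x, H x 0 = 0)
    (hγ₁ : 0 < γ₁) (hγm : 0 < γm)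
    (hHlip : ∀ x p q : En n,
      |H x p - H x q| ≤ (γ₁ + γm * (‖p‖ ^ (m - 1) + ‖q‖ ^ (m - 1))) * ‖p - q‖)
    (hu : Continuous u) (husup : ViscositySupersolution F H s f u)
    (N : ℕ) (hN : 1 ≤ N) (hN1 : (N : ℝ) + 2 ≤ N * s) (hN2 : ((N : ℝ) + 1) * m ≤ N * s)
    (C : ℝ) (hC : 0 ≤ C)
    (hT : ∀ τ : ℝ, |τ| ≤ 1/2 → ((1 - τ)⁻¹) ^ N ≤ 1 + N * τ + C * τ ^ 2)
    (K : ℝ) (hK : 1 ≤ K)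
    (hK2 : (2 * Lam * n * (N + 9 * C) + (γ₁ + 2 * γm) * (2 * N) ^ m) * K ^ m ≤ K ^ s)
    (x₀ : En n) (A : ℝ) (hA : 0 ≤ A) (hfA : ∀ x, ‖x - x₀‖ ≤ 1 → f x ≤ A ^ s) :
    -(A + K) ≤ u x₀ := by
  by_contra! hcon
  have hLam : 0 < Lam := by linarith
  have hNr : (1:ℝ) ≤ N := by exact_mod_cast hN
  have hs0 : 0 < s := by linarith
  obtain ⟨B₀, hB₀⟩ := ((isCompact_closedBall x₀ 1).image hu).bddBelow
  obtain ⟨B, hB0, hB⟩ : ∃ B : ℝ, 0 ≤ B ∧ ∀ x, ‖x - x₀‖ ≤ 1 → -B ≤ u x := by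
    refine ⟨|B₀|, abs_nonneg _, fun x hx => (neg_abs_le B₀).trans ?_⟩
    exact hB₀ ⟨x, by simpa [dist_eq_norm] using hx, rfl⟩
  set δ : ℝ := (B + 2)⁻¹ with hδ
  have hδ0 : 0 < δ := by positivity
  have hδ1 : δ < 1 := by
    rw [hδ]; exact inv_lt_one_of_one_lt₀ (by linarith)
  set S : Set (En n) := {x | ‖x - x₀‖ ^ 2 ≤ 1 - δ} with hS
  have hS1 : ∀ x ∈ S, ‖x - x₀‖ ≤ 1 := by
    intro x hx
    have : ‖x - x₀‖ ^ 2 ≤ 1 - δ := hx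
    nlinarith [norm_nonneg (x - x₀)]
  have hcn : Continuous (fun x : En n => ‖x - x₀‖ ^ 2) := by fun_prop
  have hSc : IsCompact S := by
    refine (isCompact_closedBall x₀ 1).of_isClosed_subset (isClosed_le hcn continuous_const) ?_
    intro x hx
    simpa [dist_eq_norm] using hS1 x hx
  set g : En n → ℝ := fun x => u x + (A + K * ((1 - ‖x - x₀‖ ^ 2)⁻¹) ^ N) with hg
  have hgc : ContinuousOn g S := by
    refine hu.continuousOn.add (continuousOn_const.add (continuousOn_const.mul
      (ContinuousOn.pow (ContinuousOn.inv₀ (continuous_const.sub hcn).continuousOn ?_) N)))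
    intro x hx
    have : ‖x - x₀‖ ^ 2 ≤ 1 - δ := hx
    have : 0 < 1 - ‖x - x₀‖ ^ 2 := by linarith
    exact this.ne'
  have hx0S : x₀ ∈ S := by simp [hS]; linarith
  obtain ⟨x₁, hx1S, hmin⟩ := hSc.exists_isMinOn ⟨x₀, hx0S⟩ hgc
  have hneg : g x₁ < 0 := by
    refine lt_of_le_of_lt (hmin hx0S) ?_
    simp [hg]; linarith
  have hx1n : ‖x₁ - x₀‖ ≤ 1 := hS1 x₁ hx1S
  have hlt : ‖x₁ - x₀‖ ^ 2 < 1 - δ := by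
    refine lt_of_le_of_ne hx1S fun heq => ?_
    have e : g x₁ = u x₁ + (A + K * (B + 2) ^ N) := by
      simp only [hg, heq, sub_sub_cancel, hδ, inv_inv]
    have h1 : B + 2 ≤ (B + 2) ^ N := le_self_pow₀ (by linarith) (by omega)
    have h2 := hB x₁ hx1n
    nlinarith
  have hloc : IsLocalMin g x₁ := by
    refine hmin.isLocalMin ?_
    filter_upwards [(isOpen_lt hcn continuous_const).mem_nhds hlt] with x hx
    exact le_of_lt hx
  set t : ℝ := (1 - ‖x₁ - x₀‖ ^ 2)⁻¹ with ht
  have ht1 : 1 ≤ t := by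
    rw [ht, one_le_inv₀ (by linarith)]; nlinarith [sq_nonneg ‖x₁ - x₀‖]
  have ht0 : 0 < t := by linarith
  have htouch := barrier_touch N C K A hC (by linarith) hT u x₀ x₁ t (by linarith) ht hloc
  have hv := husup _ (quadT_contDiff _ _ _ _) x₁ htouch
  rw [quadT_grad, quadT_hess] at hv
  have hF := F_lower lam Lam F hFell hF0 x₁ (2 * (K * (N + 9 * C) * t ^ (N + 2))) (by positivity)
  have htN : 1 ≤ t ^ (N+1) := one_le_pow₀ ht1
  have hP1 : 1 ≤ 2 * N * K * t ^ (N+1) := by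
    have : 1 ≤ 2 * N * K := by nlinarith
    nlinarith
  have hHl := H_lower m γ₁ γm H hm1 hH0 hγ₁ hγm hHlip x₁
    (-((2 * K * N * t ^ (N + 1)) • (x₁ - x₀))) (2 * N * K * t ^ (N+1)) hP1 (by
      rw [norm_neg, norm_smul, Real.norm_of_nonneg (by positivity)]
      calc _ ≤ 2 * K * N * t ^ (N+1) * 1 := by gcongr
        _ = _ := by ring)
  have hfx := hfA x₁ hx1n
  have hw : A + K * t ^ N < -u x₁ := by
    have : g x₁ = u x₁ + (A + K * t ^ N) := rfl
    linarith
  have hupos : 0 < -u x₁ := lt_of_le_of_lt (by positivity) hw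
  have habs : -(|u x₁| ^ (s - 1) * u x₁) = (-u x₁) ^ s := by
    rw [abs_of_neg (by linarith)]
    have : (-u x₁) ^ s = (-u x₁) ^ (s - 1) * (-u x₁) := by
      rw [← Real.rpow_add_one hupos.ne']; ring_nf
    rw [this]; ring
  have hws : (A + K * t ^ N) ^ s < (-u x₁) ^ s :=
    Real.rpow_lt_rpow (by positivity) hw hs0
  have hsup : A ^ s + (K * t ^ N) ^ s ≤ (A + K * t ^ N) ^ s :=
    Real.add_rpow_le_rpow_add hA (by positivity) (by linarith)
  set T : ℝ := t ^ ((N:ℝ) * s) with hTdef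
  have hT0 : 0 < T := by positivity
  have hKt : (K * t ^ N) ^ s = K ^ s * T := by
    rw [Real.mul_rpow (by linarith) (by positivity), hTdef, Real.rpow_mul ht0.le,
      Real.rpow_natCast]
  have hp2 : t ^ (N+2) ≤ T := by
    rw [← Real.rpow_natCast]
    exact Real.rpow_le_rpow_of_exponent_le ht1 (by push_cast; exact hN1)
  have hpm : (2 * N * K * t ^ (N+1)) ^ m ≤ (2 * N) ^ m * K ^ m * T := by
    rw [Real.mul_rpow (by positivity) (by positivity), Real.mul_rpow (by positivity) (by positivity)]
    gcongr
    rw [← Real.rpow_natCast, ← Real.rpow_mul ht0.le]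
    exact Real.rpow_le_rpow_of_exponent_le ht1 (by push_cast; exact hN2)
  have hKm : K ≤ K ^ m := by
    simpa using Real.rpow_le_rpow_of_exponent_le hK hm1
  have b1 : Lam * (2 * (K * (N + 9 * C) * t ^ (N + 2)) * n) ≤
      2 * Lam * n * (N + 9 * C) * K ^ m * T := by
    calc _ = 2 * Lam * n * (N + 9 * C) * K * t ^ (N+2) := by ring
      _ ≤ _ := by gcongr
  have b2 : (γ₁ + 2 * γm) * (2 * N * K * t ^ (N+1)) ^ m ≤
      (γ₁ + 2 * γm) * ((2 * N) ^ m * K ^ m * T) := by gcongr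
  have b3 := mul_le_mul_of_nonneg_right hK2 hT0.le
  rw [hKt] at hsup
  clear_value T t δ g S
  linarith

lemma mu_ge (m s μ : ℝ) (hm1 : 1 ≤ m) (hsm : m < s)
    (hμ : μ = if m ≤ 2 * s / (s + 1) then 2 / (s - 1) else m / (s - m)) : 1 ≤ μ * s / 2 := by
  have h1 : 0 < s - 1 := by linarith
  have h2 : 0 < s - m := by linarith
  split_ifs at hμ with h
  · rw [hμ, div_mul_eq_mul_div, div_div, one_le_div (by positivity)]
    linarith
  · rw [hμ, div_mul_eq_mul_div, div_div, one_le_div (by positivity)]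
    push Not at h
    rw [div_lt_iff₀ (by linarith)] at h
    linarith
theorem growth_of_supersolutions
    (n : ℕ) (hn : 1 ≤ n) (lam Lam m s ρ μ γ₁ γm : ℝ)
    (F : En n → Matrix (Fin n) (Fin n) ℝ → ℝ)
    (H : En n → En n → ℝ) (f u : En n → ℝ)
    (hlam : 0 < lam) (hlamLam : lam ≤ Lam)
    (hm1 : 1 ≤ m) (hm2 : m ≤ 2) (hsm : m < s)
    (hμ : μ = if m ≤ 2 * s / (s + 1) then 2 / (s - 1) else m / (s - m))
    (hFell : ∀ (x : En n) (X Y : Matrix (Fin n) (Fin n) ℝ), X.IsSymm → Y.IsSymm →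
      Y.PosSemidef →
      lam * Y.trace ≤ F x (X + Y) - F x X ∧ F x (X + Y) - F x X ≤ Lam * Y.trace)
    (hF0 : ∀ x, F x 0 = 0)
    (hFcont : ∀ X : Matrix (Fin n) (Fin n) ℝ, X.IsSymm → Continuous fun x => F x X)
    (hHcont : Continuous fun xp : En n × En n => H xp.1 xp.2)
    (hH0 : ∀ x, H x 0 = 0)
    (hγ₁ : 0 < γ₁) (hγm : 0 < γm)
    (hHlip : ∀ x p q : En n,
      |H x p - H x q| ≤ (γ₁ + γm * (‖p‖ ^ (m - 1) + ‖q‖ ^ (m - 1))) * ‖p - q‖)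
    (hf : Continuous f) (hρ : 0 ≤ ρ)
    (hflimsup : ∃ C M : ℝ, ∀ x : En n, M ≤ ‖x‖ → max (f x) 0 ≤ C * ‖x‖ ^ ρ)
    (hu : Continuous u) (husup : ViscositySupersolution F H s f u) :
    ∃ C M : ℝ, ∀ x : En n, M ≤ ‖x‖ →
      (max (-u x) 0) ^ s ≤ C * ‖x‖ ^ (μ * s * ρ / 2) := by
  have hs1 : 0 < s - 1 := by linarith
  have hsm' : 0 < s - m := by linarith
  have hs0 : 0 < s := by linarith
  have hLam : 0 < Lam := by linarith
  obtain ⟨N, hNbig⟩ := exists_nat_ge (max 1 (max (2 / (s - 1)) (m / (s - m))))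
  have hN : 1 ≤ N := by exact_mod_cast (le_max_left _ _).trans hNbig
  have hN1 : (N : ℝ) + 2 ≤ N * s := by
    have := ((le_max_left _ _).trans (le_max_right _ _)).trans hNbig
    rw [div_le_iff₀ hs1] at this
    linarith
  have hN2 : ((N : ℝ) + 1) * m ≤ N * s := by
    have := ((le_max_right _ _).trans (le_max_right _ _)).trans hNbig
    rw [div_le_iff₀ hsm'] at this
    linarith
  obtain ⟨C, hC, hT⟩ := aux_taylor N
  set C5 : ℝ := 2 * Lam * n * (N + 9 * C) + (γ₁ + 2 * γm) * (2 * N) ^ m with hC5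
  set K : ℝ := (max 1 C5) ^ (1 / (s - m)) with hKdef
  have hmax : 1 ≤ max 1 C5 := le_max_left _ _
  have hK : 1 ≤ K := Real.one_le_rpow hmax (by positivity)
  have hK2 : C5 * K ^ m ≤ K ^ s := by
    have e : K ^ s = K ^ (s - m) * K ^ m := by
      rw [← Real.rpow_add (by linarith)]; ring_nf
    have e2 : K ^ (s - m) = max 1 C5 := by
      rw [hKdef, ← Real.rpow_mul (by linarith), one_div_mul_cancel hsm'.ne', Real.rpow_one]
    rw [e, e2]
    gcongr
    exact le_max_right _ _
  obtain ⟨Cf, M, hfM⟩ := hflimsup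
  refine ⟨2 ^ s * (K ^ s + |Cf| * 2 ^ ρ), max (M + 1) 1, fun x₀ hx₀ => ?_⟩
  have hxM : M + 1 ≤ ‖x₀‖ := (le_max_left _ _).trans hx₀
  have hx1 : 1 ≤ ‖x₀‖ := (le_max_right _ _).trans hx₀
  have hbase : 0 ≤ |Cf| * (2 * ‖x₀‖) ^ ρ := by positivity
  set A : ℝ := (|Cf| * (2 * ‖x₀‖) ^ ρ) ^ (1 / s) with hAdef
  have hA : 0 ≤ A := by positivity
  have hAs : A ^ s = |Cf| * (2 * ‖x₀‖) ^ ρ := by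
    rw [hAdef, ← Real.rpow_mul hbase, one_div_mul_cancel hs0.ne', Real.rpow_one]
  have hfA : ∀ x, ‖x - x₀‖ ≤ 1 → f x ≤ A ^ s := by
    intro x hx
    have h1 : ‖x‖ ≤ 2 * ‖x₀‖ := by
      have := norm_add_le (x - x₀) x₀
      rw [sub_add_cancel] at this
      linarith
    have h2 : M ≤ ‖x‖ := by
      have := norm_sub_norm_le x₀ x
      rw [norm_sub_rev] at this
      linarith
    rw [hAs]
    calc f x ≤ max (f x) 0 := le_max_left _ _
      _ ≤ Cf * ‖x‖ ^ ρ := hfM x h2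
      _ ≤ |Cf| * (2 * ‖x₀‖) ^ ρ := by
        gcongr
        exact le_abs_self _
  have hest := local_est lam Lam m s γ₁ γm F H f u hlam hlamLam hm1 hsm hFell hF0 hH0 hγ₁ hγm
    hHlip hu husup N hN hN1 hN2 C hC hT K hK hK2 x₀ A hA hfA
  have hle : max (-u x₀) 0 ≤ 2 * max A K := by
    refine max_le ?_ (by positivity)
    have := le_max_left A K
    have := le_max_right A K
    linarith
  have hmaxs : (max A K) ^ s ≤ K ^ s + A ^ s := by
    have a1 : 0 ≤ A ^ s := by positivity
    have a2 : 0 ≤ K ^ s := by positivity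
    rcases max_cases A K with ⟨h, _⟩ | ⟨h, _⟩ <;> rw [h] <;> linarith
  have hμ1 := mu_ge m s μ hm1 hsm hμ
  have hexp : ρ ≤ μ * s * ρ / 2 := by nlinarith
  have hpow : ‖x₀‖ ^ ρ ≤ ‖x₀‖ ^ (μ * s * ρ / 2) :=
    Real.rpow_le_rpow_of_exponent_le hx1 hexp
  have hone : 1 ≤ ‖x₀‖ ^ ρ := Real.one_le_rpow hx1 hρ
  calc (max (-u x₀) 0) ^ s ≤ (2 * max A K) ^ s :=
        Real.rpow_le_rpow (le_max_right _ _) hle hs0.le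
    _ = 2 ^ s * (max A K) ^ s := Real.mul_rpow (by norm_num) (by positivity)
    _ ≤ 2 ^ s * (K ^ s + A ^ s) := by gcongr
    _ = 2 ^ s * (K ^ s * 1 + |Cf| * 2 ^ ρ * ‖x₀‖ ^ ρ) := by
        rw [hAs, Real.mul_rpow (by norm_num) (norm_nonneg _)]; ring
    _ ≤ 2 ^ s * (K ^ s * ‖x₀‖ ^ ρ + |Cf| * 2 ^ ρ * ‖x₀‖ ^ ρ) := by gcongr
    _ = 2 ^ s * (K ^ s + |Cf| * 2 ^ ρ) * ‖x₀‖ ^ ρ := by ring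
    _ ≤ _ := by gcongr
end
end

section
/- Let n ≥ 1, 0 < λ ≤ Λ, m > 1 and s > 1. Let F : ℝⁿ × Sⁿ → ℝ (Sⁿ the symmetric n×n real matrices) satisfy: (i) λ·Tr(Y) ≤ F(x,X+Y) − F(x,X) ≤ Λ·Tr(Y) for all x, all X ∈ Sⁿ and all positive semidefinite Y ∈ Sⁿ; (ii) x ↦ F(x,X) is continuous for each X; (iii) for every R > 0 there is a modulus of continuity ω_R such that F(x,X) − F(y,Y) ≤ ω_R(|x−y| + ε⁻¹|x−y|²) whenever ε > 0, |x|,|y| < R and X,Y ∈ Sⁿ satisfy the block inequalities −(3/ε)[[I,0],[0,I]] ≤ [[X,0],[0,−Y]] ≤ (3/ε)[[I,−I],[−I,I]] in the positive semidefinite order on 2n×2n symmetric matrices; (iv) F(x,σX) = σF(x,X) for all σ ∈ (0,1). Let H : ℝⁿ × ℝⁿ → ℝ satisfy: (a) |H(x,p+q) − H(y,p)| ≤ ω(|x−y|)(|p|^m + 1) + (γ₁ + γ_m(|p|^{m−1} + |q|^{m−1}))|q| for all x,y,p,q, for some constants γ₁, γ_m > 0 and a modulus of continuity ω; (b) there exist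 c̄, A > 0 and σ₀ ∈ (0,1) such that H(x,p) − σH(x,σ⁻¹p) ≤ (1−σ)(−c̄|p|^m + A) for all x,p and all σ ∈ (σ₀,1). Let f : ℝⁿ → ℝ be continuous, let u be a continuous viscosity subsolution and v a continuous viscosity supersolution of F(x,D²u) + H(x,Du) − |u|^{s−1}u = f(x) in ℝⁿ. Set γ̃ = γ_m + (m−1)^{m−1} γ_m^m / (m^m c̄^{m−1}). Then for every σ ∈ (σ₀,1) the function w_σ = u − σv is a continuous viscosity subsolution in ℝⁿ of P⁺_{λ,Λ}(D²w_σ) + γ₁|Dw_σ| + (1−σ)^{1−m} γ̃ |Dw_σ|^m − (|u|^{s−1}u − |σv|^{s−1}(σv)) + (σ − σ^s)|v|^{s−1}v ≥ (1−σ)(f(x) − A); explicitly, for every C² function φ : ℝⁿ → ℝ and every point x₀ at which w_σ − φ attains a local maximum, P⁺_{λ,Λ}(D²φ(x₀)) + γ₁|Dφ(x₀)| + (1−σ)^{1−m} γ̃ |Dφ(x₀)|^m − (|u(x₀)|^{s−1}u(x₀) − |σv(x₀)|^{s−1}σv(x₀)) + (σ − σ^s)|v(x₀)|^{s−1}v(x₀)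 ≥ (1−σ)(f(x₀) − A). -/
noncomputable section
open Real

section Abstract
variable {E : Type*} [NormedAddCommGroup E] [InnerProductSpace ℝ E]

/-- The subdifferential. -/
def SubG (G : E → ℝ) (x : E) : Set E := {a | ∀ y, G x + inner ℝ a (y - x) ≤ G y}

lemma SubG.mono {G : E → ℝ} {x y a b : E} (ha : a ∈ SubG G x) (hb : b ∈ SubG G y) :
    0 ≤ inner ℝ (a - b) (x - y) := by
  have h1 := ha y
  have h2 := hb x
  have h3 : (inner ℝ a (y - x) : ℝ) = - inner ℝ a (x - y) := by
    rw [← inner_neg_right, neg_sub]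
  rw [inner_sub_left]
  linarith

lemma SubG.convex_ineq {G : E → ℝ} (hS : ∀ x, (SubG G x).Nonempty) (x y : E) {s : ℝ}
    (hs0 : 0 ≤ s) (hs1 : s ≤ 1) : G (x + s • (y - x)) ≤ (1 - s) * G x + s * G y := by
  obtain ⟨a, ha⟩ := hS (x + s • (y - x))
  have h1 := ha x
  have h2 := ha y
  have e1 : x - (x + s • (y - x)) = (-s) • (y - x) := by module
  have e2 : y - (x + s • (y - x)) = (1 - s) • (y - x) := by module
  rw [e1, inner_smul_right] at h1
  rw [e2, inner_smul_right] at h2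
  have h3 := mul_le_mul_of_nonneg_left h1 (sub_nonneg.2 hs1)
  have h4 := mul_le_mul_of_nonneg_left h2 hs0
  nlinarith

lemma SubG.of_min {G : E → ℝ} (hS : ∀ x, (SubG G x).Nonempty) {t x : E}
    (hx : ∀ y, G x + ‖x - t‖ ^ 2 / 2 ≤ G y + ‖y - t‖ ^ 2 / 2) : t - x ∈ SubG G x := by
  intro y
  by_contra! hlt
  set d := G x + inner ℝ (t - x) (y - x) - G y with hd
  have hdpos : 0 < d := by linarith
  have key : ∀ s : ℝ, 0 < s → s ≤ 1 → d ≤ s * (‖y - x‖ ^ 2 / 2) := by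
    intro s hs hs1
    have h1 := hx (x + s • (y - x))
    have h2 := SubG.convex_ineq hS x y hs.le hs1
    have e : x + s • (y - x) - t = (x - t) + s • (y - x) := by abel
    have h3 : ‖x + s • (y - x) - t‖ ^ 2 = ‖x - t‖ ^ 2 + 2 * (s * inner ℝ (x - t) (y - x))
        + s ^ 2 * ‖y - x‖ ^ 2 := by
      rw [e, norm_add_sq_real, inner_smul_right, norm_smul, mul_pow, Real.norm_eq_abs, sq_abs]
    have h4 : (inner ℝ (x - t) (y - x) : ℝ) = - inner ℝ (t - x) (y - x) := by
      rw [← inner_neg_left, neg_sub]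
    rw [h3, h4] at h1
    have : s * d ≤ s * (s * (‖y - x‖ ^ 2 / 2)) := by
      rw [hd]; nlinarith
    exact le_of_mul_le_mul_left this hs
  have hs : ∃ s : ℝ, 0 < s ∧ s ≤ 1 ∧ s * (‖y - x‖ ^ 2 / 2) < d := by
    refine ⟨min 1 (d / (‖y - x‖ ^ 2 + 1)), by positivity, min_le_left _ _, ?_⟩
    calc min 1 (d / (‖y - x‖ ^ 2 + 1)) * (‖y - x‖ ^ 2 / 2)
        ≤ (d / (‖y - x‖ ^ 2 + 1)) * (‖y - x‖ ^ 2 / 2) := by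
          gcongr; exact min_le_right _ _
      _ < d := by
          rw [div_mul_eq_mul_div, div_lt_iff₀ (by positivity)]
          nlinarith [sq_nonneg ‖y - x‖]
  obtain ⟨s, h1, h2, h3⟩ := hs
  linarith [key s h1 h2]

lemma SubG.resolvent [FiniteDimensional ℝ E] {G : E → ℝ} (hG : Continuous G)
    (hS : ∀ x, (SubG G x).Nonempty) (t : E) : ∃ x, t - x ∈ SubG G x := by
  obtain ⟨a, ha⟩ := hS 0
  have hc : Continuous fun x => G x + ‖x - t‖ ^ 2 / 2 := by fun_prop
  have := hc.exists_forall_le' 0 (by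
    filter_upwards [(tendsto_norm_cocompact_atTop (E := E)).eventually_ge_atTop (2 * ‖t - a‖)]
      with x hx
    have h1 := ha x
    rw [sub_zero] at h1
    have h2 : ‖x - t‖ ^ 2 = ‖x‖ ^ 2 - 2 * inner ℝ x t + ‖t‖ ^ 2 := norm_sub_sq_real x t
    have h3 : (inner ℝ (t - a) x : ℝ) ≤ ‖t - a‖ * ‖x‖ := real_inner_le_norm _ _
    rw [inner_sub_left, real_inner_comm] at h3
    rw [h2, zero_sub, norm_neg]
    nlinarith [norm_nonneg x])
  obtain ⟨x, hx⟩ := this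
  exact ⟨x, SubG.of_min hS hx⟩

lemma SubG.nonexpansive {G : E → ℝ} {s t x y : E} (hx : s - x ∈ SubG G x)
    (hy : t - y ∈ SubG G y) : ‖x - y‖ ≤ ‖s - t‖ := by
  have h := SubG.mono hx hy
  have e : s - x - (t - y) = (s - t) - (x - y) := by abel
  rw [e, inner_sub_left, real_inner_self_eq_norm_sq] at h
  have h2 : (inner ℝ (s - t) (x - y) : ℝ) ≤ ‖s - t‖ * ‖x - y‖ := real_inner_le_norm _ _
  by_contra! hlt
  have := norm_nonneg (s - t)
  nlinarith

lemma one_dim_sum {g : ℝ → ℝ} {A B : ℝ}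
    (h : ∀ s s', 0 ≤ s → s ≤ s' → s' ≤ 1 → g s' - g s ≤ (s' - s) * (A + s' * B)) :
    g 1 - g 0 ≤ A + B / 2 := by
  have key : ∀ N : ℕ, g 1 - g 0 ≤ A + (1 + 1 / ((N : ℝ) + 1)) * (B / 2) := by
    intro N
    have hN : (0 : ℝ) < (N : ℝ) + 1 := by positivity
    have ind : ∀ j : ℕ, j ≤ N + 1 → g (j / ((N : ℝ) + 1)) - g 0 ≤
        (j / ((N : ℝ) + 1)) * A + (j * (j + 1) / ((N : ℝ) + 1) ^ 2) * (B / 2) := by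
      intro j
      induction j with
      | zero => intro _; simp
      | succ j ih =>
        intro hj
        have h1 := ih (by omega)
        have hj' : ((j : ℝ) + 1) ≤ N + 1 := by exact_mod_cast hj
        have h2 := h (j / ((N : ℝ) + 1)) (((j : ℝ) + 1) / ((N : ℝ) + 1)) (by positivity)
          (by gcongr; linarith) (by rw [div_le_one hN]; exact hj')
        push_cast
        have e : (((j : ℝ) + 1) / ((N : ℝ) + 1) - j / ((N : ℝ) + 1)) *
            (A + ((j : ℝ) + 1) / ((N : ℝ) + 1) * B) + ((j / ((N : ℝ) + 1)) * A +
            (j * (j + 1) / ((N : ℝ) + 1) ^ 2) * (B / 2)) =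
            (((j : ℝ) + 1) / ((N : ℝ) + 1)) * A +
            (((j : ℝ) + 1) * ((j : ℝ) + 1 + 1) / ((N : ℝ) + 1) ^ 2) * (B / 2) := by
          field_simp; ring
        linarith
    have h1 := ind (N + 1) le_rfl
    push_cast at h1
    rw [div_self hN.ne'] at h1
    have e : ((N : ℝ) + 1) * ((N : ℝ) + 1 + 1) / ((N : ℝ) + 1) ^ 2 = 1 + 1 / ((N : ℝ) + 1) := by
      field_simp
    rw [e, one_mul] at h1
    exact h1
  have hlim : Filter.Tendsto (fun N : ℕ => A + (1 + 1 / ((N : ℝ) + 1)) * (B / 2)) Filter.atTop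
      (nhds (A + (1 + 0) * (B / 2))) :=
    ((tendsto_one_div_add_atTop_nhds_zero_nat.const_add 1).mul_const _).const_add _
  have := ge_of_tendsto' hlim key
  linarith

lemma one_dim_sum' {g : ℝ → ℝ} {A B : ℝ}
    (h : ∀ s s', 0 ≤ s → s ≤ s' → s' ≤ 1 → (s' - s) * (A + s * B) ≤ g s' - g s) :
    A + B / 2 ≤ g 1 - g 0 := by
  have := one_dim_sum (g := fun s => g (1 - s)) (A := -A - B) (B := B) (by
    intro s s' h0 h1 h2
    have := h (1 - s') (1 - s) (by linarith) (by linarith) (by linarith)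
    nlinarith)
  simp only [sub_self, sub_zero] at this
  linarith

/-- second-order expansion at a point where the subdifferential is differentiable -/
lemma SubG.expansion {G : E → ℝ} (hS : ∀ x, (SubG G x).Nonempty) {x₀ a : E} {L : E →L[ℝ] E}
    (hL : ∀ ε > 0, ∃ r > 0, ∀ h : E, ‖h‖ < r → ∀ b ∈ SubG G (x₀ + h),
      ‖b - a - L h‖ ≤ ε * ‖h‖) :
    ∀ ε > 0, ∃ r > 0, ∀ h : E, ‖h‖ < r →
      |G (x₀ + h) - G x₀ - inner ℝ a h - inner ℝ (L h) h / 2| ≤ ε * ‖h‖ ^ 2 := by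
  intro ε hε
  obtain ⟨r, hr, H⟩ := hL ε hε
  refine ⟨r, hr, fun h hh => ?_⟩
  have hb : ∀ s : ℝ, 0 ≤ s → s ≤ 1 → ∀ b ∈ SubG G (x₀ + s • h),
      |inner ℝ b h - (inner ℝ a h + s * inner ℝ (L h) h)| ≤ ε * ‖h‖ ^ 2 := by
    intro s h0 h1 b hb
    have hn : ‖s • h‖ ≤ ‖h‖ := by
      rw [norm_smul, Real.norm_eq_abs, abs_of_nonneg h0]
      nlinarith [norm_nonneg h]
    have h2 := H (s • h) (lt_of_le_of_lt hn hh) b hb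
    have e : (inner ℝ b h - (inner ℝ a h + s * inner ℝ (L h) h) : ℝ)
        = inner ℝ (b - a - L (s • h)) h := by
      rw [map_smul, inner_sub_left, inner_sub_left, inner_smul_left]
      simp; ring
    rw [e]
    calc _ ≤ ‖b - a - L (s • h)‖ * ‖h‖ := abs_real_inner_le_norm _ _
      _ ≤ (ε * ‖h‖) * ‖h‖ := by
        gcongr; exact h2.trans (by gcongr)
      _ = _ := by ring
  have up := one_dim_sum (g := fun s => G (x₀ + s • h)) (A := inner ℝ a h + ε * ‖h‖ ^ 2)
    (B := inner ℝ (L h) h) (by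
      intro s s' h0 h1 h2
      obtain ⟨b, hbm⟩ := hS (x₀ + s' • h)
      have h3 := hbm (x₀ + s • h)
      have e : x₀ + s • h - (x₀ + s' • h) = (-(s' - s)) • h := by module
      rw [e, inner_smul_right] at h3
      have h4 := (abs_le.1 (hb s' (h0.trans h1) h2 b hbm)).2
      nlinarith [sub_nonneg.2 h1])
  have lo := one_dim_sum' (g := fun s => G (x₀ + s • h)) (A := inner ℝ a h - ε * ‖h‖ ^ 2)
    (B := inner ℝ (L h) h) (by
      intro s s' h0 h1 h2
      obtain ⟨b, hbm⟩ := hS (x₀ + s • h)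
      have h3 := hbm (x₀ + s' • h)
      have e : x₀ + s' • h - (x₀ + s • h) = (s' - s) • h := by module
      rw [e, inner_smul_right] at h3
      have h4 := (abs_le.1 (hb s h0 (h1.trans h2) b hbm)).1
      nlinarith [sub_nonneg.2 h1])
  simp only [one_smul, zero_smul, add_zero] at up lo
  rw [abs_le]
  constructor <;> linarith

lemma SubG.lip_of_touch {G : E → ℝ} {x₀ a : E} {C : ℝ} (hC : 0 < C) (ha : a ∈ SubG G x₀)
    (ht : ∀ h, G (x₀ + h) ≤ G x₀ + inner ℝ a h + C * ‖h‖ ^ 2) {h b : E}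
    (hb : b ∈ SubG G (x₀ + h)) : ‖b - a‖ ≤ 4 * C * ‖h‖ := by
  set w := b - a with hw
  have h1 := ha (x₀ + h)
  rw [add_sub_cancel_left] at h1
  have h2 := hb (x₀ + (h + (4 * C)⁻¹ • w))
  have e : x₀ + (h + (4 * C)⁻¹ • w) - (x₀ + h) = (4 * C)⁻¹ • w := by abel
  rw [e, inner_smul_right] at h2
  have h3 := ht (h + (4 * C)⁻¹ • w)
  rw [inner_add_right, inner_smul_right] at h3
  have h4 : ‖h + (4 * C)⁻¹ • w‖ ^ 2 ≤ 2 * ‖h‖ ^ 2 + 2 * ((4 * C)⁻¹ ^ 2 * ‖w‖ ^ 2) := by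
    have := norm_add_le h ((4 * C)⁻¹ • w)
    rw [norm_smul, Real.norm_eq_abs, abs_of_pos (by positivity)] at this
    have h5 := norm_nonneg (h + (4 * C)⁻¹ • w)
    nlinarith [sq_nonneg (‖h‖ - (4 * C)⁻¹ * ‖w‖)]
  have h5 : (inner ℝ b w - inner ℝ a w : ℝ) = ‖w‖ ^ 2 := by
    rw [← inner_sub_left, ← hw, real_inner_self_eq_norm_sq]
  have h6 : (4 * C)⁻¹ * ‖w‖ ^ 2 ≤ C * (2 * ‖h‖ ^ 2 + 2 * ((4 * C)⁻¹ ^ 2 * ‖w‖ ^ 2)) := by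
    have := mul_le_mul_of_nonneg_left h4 hC.le
    have h9 : (4 * C)⁻¹ * ‖w‖ ^ 2 = (4 * C)⁻¹ * inner ℝ b w - (4 * C)⁻¹ * inner ℝ a w := by
      rw [← h5]; ring
    linarith
  have h7 : ‖w‖ ^ 2 ≤ (4 * C * ‖h‖) ^ 2 := by
    have h8 : 8 * C * ((4 * C)⁻¹ * ‖w‖ ^ 2) ≤
      8 * C * (C * (2 * ‖h‖ ^ 2 + 2 * ((4 * C)⁻¹ ^ 2 * ‖w‖ ^ 2))) := by gcongr
    have e1 : 8 * C * ((4 * C)⁻¹ * ‖w‖ ^ 2) = 2 * ‖w‖ ^ 2 := by field_simp; ring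
    have e2 : 8 * C * (C * (2 * ‖h‖ ^ 2 + 2 * ((4 * C)⁻¹ ^ 2 * ‖w‖ ^ 2))) =
      16 * C ^ 2 * ‖h‖ ^ 2 + ‖w‖ ^ 2 := by field_simp; ring
    rw [e1, e2] at h8
    nlinarith
  exact abs_le_of_sq_le_sq' h7 (by positivity) |>.2

lemma SubG.alexandrov [FiniteDimensional ℝ E] {G : E → ℝ} (hS : ∀ x, (SubG G x).Nonempty)
    {J : E → E} (hJ : ∀ t, t - J t ∈ SubG G (J t)) {x₀ a : E} {C : ℝ} (hC : 0 < C)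
    (ha : a ∈ SubG G x₀)
    (ht : ∀ h, G (x₀ + h) ≤ G x₀ + inner ℝ a h + C * ‖h‖ ^ 2)
    (hd : DifferentiableAt ℝ J (x₀ + a)) :
    ∃ L : E →L[ℝ] E, ∀ ε > 0, ∃ r > 0, ∀ h : E, ‖h‖ < r →
      |G (x₀ + h) - G x₀ - inner ℝ a h - inner ℝ (L h) h / 2| ≤ ε * ‖h‖ ^ 2 := by
  have hJu : ∀ x b, b ∈ SubG G x → J (x + b) = x := by
    intro x b hb
    have := SubG.nonexpansive (hJ (x + b)) (y := x) (t := x + b) (by simpa using hb)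
    rw [sub_self, norm_zero] at this
    exact sub_eq_zero.1 (norm_le_zero_iff.1 this)
  set t₀ := x₀ + a with ht₀
  have hJ0 : J t₀ = x₀ := hJu _ _ ha
  set D := fderiv ℝ J t₀ with hD
  have hDJ : ∀ ε > 0, ∃ r > 0, ∀ τ, ‖τ‖ < r → ‖J (t₀ + τ) - J t₀ - D τ‖ ≤ ε * ‖τ‖ := by
    intro ε hε
    have := (hasFDerivAt_iff_isLittleO_nhds_zero.1 hd.hasFDerivAt).def hε
    obtain ⟨r, hr, H⟩ := Metric.eventually_nhds_iff.1 this
    exact ⟨r, hr, fun τ hτ => H (by simpa using hτ)⟩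
  -- expansion of the resolvent at t₀
  have hanti : ∀ τ, ‖τ‖ ≤ (1 + 4 * C) * ‖J (t₀ + τ) - J t₀‖ := by
    intro τ
    have h1 := hJ (t₀ + τ)
    set h := J (t₀ + τ) - J t₀ with hh
    have e : J (t₀ + τ) = x₀ + h := by rw [hh, hJ0]; abel
    rw [e] at h1
    have h2 := SubG.lip_of_touch hC ha ht h1
    have e2 : τ = h + (t₀ + τ - (x₀ + h) - a) := by rw [ht₀]; abel
    calc ‖τ‖ = ‖h + (t₀ + τ - (x₀ + h) - a)‖ := by rw [← e2]
      _ ≤ ‖h‖ + ‖t₀ + τ - (x₀ + h) - a‖ := norm_add_le _ _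
      _ ≤ _ := by linarith
  have hinj : Function.Injective D := by
    rw [injective_iff_map_eq_zero]
    intro τ hτ
    obtain ⟨r, hr, H⟩ := hDJ (1 / (2 * (1 + 4 * C))) (by positivity)
    set c := r / (2 * (‖τ‖ + 1)) with hc
    have hcpos : 0 < c := by positivity
    have h1 : ‖c • τ‖ < r := by
      rw [norm_smul, Real.norm_eq_abs, abs_of_pos hcpos, hc, div_mul_eq_mul_div,
        div_lt_iff₀ (by positivity)]
      nlinarith [norm_nonneg τ]
    have h2 := H _ h1
    rw [map_smul, hτ, smul_zero, sub_zero] at h2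
    have h3 := hanti (c • τ)
    have h4 : (1 + 4 * C) * ‖J (t₀ + c • τ) - J t₀‖ ≤
        (1 + 4 * C) * (1 / (2 * (1 + 4 * C)) * ‖c • τ‖) := by gcongr
    have e : (1 + 4 * C) * (1 / (2 * (1 + 4 * C)) * ‖c • τ‖) = ‖c • τ‖ / 2 := by
      field_simp
    have h5 : ‖c • τ‖ ≤ 0 := by linarith
    have h6 := norm_le_zero_iff.1 h5
    exact (smul_eq_zero.1 h6).resolve_left hcpos.ne'
  let De : E ≃ₗ[ℝ] E := LinearEquiv.ofInjectiveEndo (D : E →ₗ[ℝ] E) hinj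
  let Di : E →L[ℝ] E := LinearMap.toContinuousLinearMap (De.symm : E →ₗ[ℝ] E)
  have hDi : ∀ τ, Di (D τ) = τ := fun τ => De.symm_apply_apply τ
  refine ⟨Di - ContinuousLinearMap.id ℝ E, SubG.expansion hS ?_⟩
  intro ε hε
  obtain ⟨r, hr, H⟩ := hDJ (ε / ((‖Di‖ + 1) * (1 + 4 * C))) (by positivity)
  refine ⟨r / (1 + 4 * C), by positivity, fun h hh b hb => ?_⟩
  have h1 : J (x₀ + h + b) = x₀ + h := hJu _ _ hb
  set τ := x₀ + h + b - t₀ with hτ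
  have e1 : t₀ + τ = x₀ + h + b := by rw [hτ]; abel
  have e2 : J (t₀ + τ) - J t₀ = h := by rw [e1, h1, hJ0]; abel
  have h2 := hanti τ
  rw [e2] at h2
  have h3 : ‖τ‖ < r := by
    refine lt_of_le_of_lt h2 ?_
    rwa [mul_comm, ← lt_div_iff₀ (by positivity)]
  have h4 := H τ h3
  rw [e2] at h4
  have e3 : b - a - (Di - ContinuousLinearMap.id ℝ E) h = - Di (h - D τ) := by
    rw [map_sub, hDi]
    simp only [sub_apply, ContinuousLinearMap.id_apply]
    rw [hτ, ht₀]; abel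
  rw [e3, norm_neg]
  calc ‖Di (h - D τ)‖ ≤ ‖Di‖ * ‖h - D τ‖ := Di.le_opNorm _
    _ ≤ (‖Di‖ + 1) * (ε / ((‖Di‖ + 1) * (1 + 4 * C)) * ((1 + 4 * C) * ‖h‖)) := by
        gcongr
        · linarith
        · exact h4.trans (by gcongr)
    _ = ε * ‖h‖ := by field_simp

open MeasureTheory in
/-- The Jensen lemma and the Alexandrov theorem combined. -/
lemma SubG.jensen_alexandrov [FiniteDimensional ℝ E]
    {G : E → ℝ} (hG : Continuous G)
    (hS : ∀ x, (SubG G x).Nonempty) (B : E →L[ℝ] E) {ε : ℝ} (hε : 0 < ε) :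
    ∃ q : E, ‖q‖ < ε ∧ ∀ (z a : E) (C : ℝ), 0 < C → a ∈ SubG G z → a = B z + q →
      (∀ h, G (z + h) ≤ G z + inner ℝ a h + C * ‖h‖ ^ 2) →
      ∃ L : E →L[ℝ] E, ∀ ε > 0, ∃ r > 0, ∀ h : E, ‖h‖ < r →
        |G (z + h) - G z - inner ℝ a h - inner ℝ (L h) h / 2| ≤ ε * ‖h‖ ^ 2 := by
  borelize E
  choose J hJ using SubG.resolvent hG hS
  have hlip : LipschitzWith 1 J := LipschitzWith.of_dist_le_mul (by
    intro s t
    rw [dist_eq_norm, dist_eq_norm]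
    simpa using SubG.nonexpansive (hJ s) (hJ t))
  let μ : Measure E := Measure.hausdorffMeasure (Module.finrank ℝ E : ℝ)
  let N : Set E := {t | ¬ DifferentiableAt ℝ J t}
  have hN : μ N = 0 := hlip.ae_differentiableAt (μ := μ)
  let Q : E → E := fun t => (t - J t) - B (J t)
  have hQ : ∃ K, LipschitzWith K Q :=
    ⟨_, (LipschitzWith.id.sub hlip).sub (B.lipschitz.comp hlip)⟩
  obtain ⟨K, hK⟩ := hQ
  have hQN : μ (Q '' N) = 0 := by
    have := hK.hausdorffMeasure_image_le (d := (Module.finrank ℝ E : ℝ)) (by positivity) N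
    refine le_antisymm (this.trans ?_) bot_le
    change _ * μ N ≤ 0
    rw [hN, mul_zero]
  have hball : 0 < μ (Metric.ball (0 : E) ε) := Metric.isOpen_ball.measure_pos μ ⟨0, by simpa⟩
  have : ∃ q ∈ Metric.ball (0 : E) ε, q ∉ Q '' N := by
    by_contra! hcon
    exact (lt_of_lt_of_le hball (measure_mono hcon)).ne' hQN
  obtain ⟨q, hq, hqN⟩ := this
  refine ⟨q, by simpa using hq, fun z a C hC ha haq ht => ?_⟩
  refine SubG.alexandrov hS hJ hC ha ht ?_
  by_contra hnd
  refine hqN ⟨z + a, hnd, ?_⟩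
  have hJu : J (z + a) = z := by
    have := SubG.nonexpansive (hJ (z + a)) (y := z) (t := z + a) (by simpa using ha)
    rw [sub_self, norm_zero] at this
    exact sub_eq_zero.1 (norm_le_zero_iff.1 this)
  simp only [Q, hJu]
  rw [haq]; abel

end Abstract
section MatrixPart
variable {n : ℕ}

/-- The linear operator of a matrix. -/
def cl (X : Matrix (Fin n) (Fin n) ℝ) : En n →L[ℝ] En n :=
  Matrix.toEuclideanCLM (n := Fin n) (𝕜 := ℝ) X

lemma cl_inner (X : Matrix (Fin n) (Fin n) ℝ) (x y : En n) :
    inner ℝ (cl X x) y = ∑ i, ∑ j, X i j * x j * y i := by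
  rw [real_inner_comm, cl, Matrix.inner_toEuclideanCLM]
  simp only [dotProduct, Matrix.mulVec, Finset.mul_sum]
  refine Finset.sum_congr rfl fun i _ => Finset.sum_congr rfl fun j _ => ?_
  ring

lemma cl_inner_single (X : Matrix (Fin n) (Fin n) ℝ) (i j : Fin n) :
    inner ℝ (cl X (EuclideanSpace.single i 1)) (EuclideanSpace.single j 1) = X j i := by
  rw [cl_inner]
  simp

lemma cl_symm {X : Matrix (Fin n) (Fin n) ℝ} (hX : X.IsSymm) (x y : En n) :
    inner ℝ (cl X x) y = inner ℝ (cl X y) x := by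
  rw [cl_inner, cl_inner, Finset.sum_comm]
  refine Finset.sum_congr rfl fun i _ => Finset.sum_congr rfl fun j _ => ?_
  rw [hX.apply i j]; ring

lemma cl_add (X Y : Matrix (Fin n) (Fin n) ℝ) : cl (X + Y) = cl X + cl Y := map_add _ _ _
lemma cl_sub (X Y : Matrix (Fin n) (Fin n) ℝ) : cl (X - Y) = cl X - cl Y := map_sub _ _ _
lemma cl_neg (X : Matrix (Fin n) (Fin n) ℝ) : cl (-X) = -cl X := map_neg _ _
lemma cl_smul (c : ℝ) (X : Matrix (Fin n) (Fin n) ℝ) : cl (c • X) = c • cl X := map_smul _ _ _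
lemma cl_one : cl (1 : Matrix (Fin n) (Fin n) ℝ) = ContinuousLinearMap.id ℝ (En n) := map_one _

/-- quadratic polynomial -/
def quadP (x₀ b : En n) (X : Matrix (Fin n) (Fin n) ℝ) (x : En n) : ℝ :=
  inner ℝ b (x - x₀) + inner ℝ (cl X (x - x₀)) (x - x₀) / 2

lemma quadP_contDiff (x₀ b : En n) (X : Matrix (Fin n) (Fin n) ℝ) :
    ContDiff ℝ 2 (quadP x₀ b X) := by
  unfold quadP
  refine ContDiff.add (contDiff_const.inner ℝ (by fun_prop)) (ContDiff.div_const
    (ContDiff.inner ℝ ((cl X).contDiff.comp (by fun_prop)) (by fun_prop)) _)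

lemma quadP_hasFDerivAt (x₀ b : En n) {X : Matrix (Fin n) (Fin n) ℝ} (hX : X.IsSymm) (x : En n) :
    HasFDerivAt (quadP x₀ b X) (innerSL ℝ (b + cl X (x - x₀))) x := by
  have h1 : HasFDerivAt (fun x : En n => x - x₀) (ContinuousLinearMap.id ℝ (En n)) x :=
    (hasFDerivAt_id x).sub_const x₀
  have h2 : HasFDerivAt (fun x : En n => cl X (x - x₀)) ((cl X).comp
    (ContinuousLinearMap.id ℝ (En n))) x := (cl X).hasFDerivAt.comp x h1
  have h3 := ((hasFDerivAt_const b x).inner ℝ h1).add ((h2.inner ℝ h1).mul_const (1/2 : ℝ))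
  have h4 : quadP x₀ b X = fun x => inner ℝ b (x - x₀) +
      inner ℝ (cl X (x - x₀)) (x - x₀) * (1/2 : ℝ) := by
    funext x; unfold quadP; ring
  rw [h4]
  refine h3.congr_fderiv ?_
  ext k
  have := cl_symm hX k (x - x₀)
  simp only [fderivInnerCLM_apply, inner_add_left, add_apply, smul_apply, ContinuousLinearMap.comp_apply,
    ContinuousLinearMap.prod_apply, zero_apply, ContinuousLinearMap.id_apply, inner_zero_left, innerSL_apply_apply,
    this, smul_eq_mul]
  ring

lemma quadP_gradient (x₀ b : En n) {X : Matrix (Fin n) (Fin n) ℝ} (hX : X.IsSymm) (x : En n) :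
    gradient (quadP x₀ b X) x = b + cl X (x - x₀) := by
  apply HasGradientAt.gradient
  rw [hasGradientAt_iff_hasFDerivAt]
  exact quadP_hasFDerivAt x₀ b hX x

lemma hessian_apply {φ : En n → ℝ} (_ : ContDiff ℝ 2 φ) (x : En n) (i j : Fin n) :
    hessianMatrix φ x i j =
      fderiv ℝ (fderiv ℝ φ) x (EuclideanSpace.single i 1) (EuclideanSpace.single j 1) := by
  unfold hessianMatrix
  rw [iteratedFDeriv_two_apply]
  simp

lemma quadP_hessian (x₀ b : En n) {X : Matrix (Fin n) (Fin n) ℝ} (hX : X.IsSymm) (x : En n) :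
    hessianMatrix (quadP x₀ b X) x = X := by
  ext i j
  rw [hessian_apply (quadP_contDiff x₀ b X)]
  have hd : DifferentiableAt ℝ (fderiv ℝ (quadP x₀ b X)) x :=
    ((quadP_contDiff x₀ b X).fderiv_right (m := 1) (by norm_num)).differentiable
      (by norm_num) x
  set k : En n := EuclideanSpace.single j 1
  have h1 : HasFDerivAt (fun y => fderiv ℝ (quadP x₀ b X) y k)
      ((ContinuousLinearMap.apply ℝ ℝ k).comp (fderiv ℝ (fderiv ℝ (quadP x₀ b X)) x)) x :=
    (ContinuousLinearMap.apply ℝ ℝ k).hasFDerivAt.comp x hd.hasFDerivAt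
  have h2 : (fun y => fderiv ℝ (quadP x₀ b X) y k) = fun y => innerSL ℝ k (b + cl X (y - x₀)) := by
    funext y
    rw [(quadP_hasFDerivAt x₀ b hX y).fderiv]
    simp only [innerSL_apply_apply]
    rw [real_inner_comm]
  have h0 : HasFDerivAt (fun x : En n => x - x₀) (ContinuousLinearMap.id ℝ (En n)) x :=
    (hasFDerivAt_id x).sub_const x₀
  have h5 : HasFDerivAt (fun x : En n => cl X (x - x₀)) ((cl X).comp
    (ContinuousLinearMap.id ℝ (En n))) x := (cl X).hasFDerivAt.comp x h0
  have h6 : HasFDerivAt (fun x : En n => b + cl X (x - x₀)) ((cl X).comp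
    (ContinuousLinearMap.id ℝ (En n))) x := h5.const_add b
  have h3 : HasFDerivAt (fun y => innerSL ℝ k (b + cl X (y - x₀))) ((innerSL ℝ k).comp
    ((cl X).comp (ContinuousLinearMap.id ℝ (En n)))) x := (innerSL ℝ k).hasFDerivAt.comp x h6
  rw [h2] at h1
  have h4 := congrArg (fun L => L (EuclideanSpace.single i 1)) (h1.unique h3)
  simp only [ContinuousLinearMap.comp_apply, ContinuousLinearMap.apply_apply,
    innerSL_apply_apply, ContinuousLinearMap.id_apply] at h4
  rw [h4, real_inner_comm, cl_inner_single, hX.apply]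

lemma hessian_symm {φ : En n → ℝ} (hφ : ContDiff ℝ 2 φ) (x : En n) :
    (hessianMatrix φ x).IsSymm := by
  ext i j
  rw [Matrix.transpose_apply, hessian_apply hφ, hessian_apply hφ]
  exact (hφ.contDiffAt.isSymmSndFDerivAt (by simp)).eq _ _

lemma hessian_cl {φ : En n → ℝ} (hφ : ContDiff ℝ 2 φ) (x h k : En n) :
    inner ℝ (cl (hessianMatrix φ x) h) k = fderiv ℝ (fderiv ℝ φ) x h k := by
  set D := fderiv ℝ (fderiv ℝ φ) x
  have e : ∀ h : En n, h = ∑ i, h i • EuclideanSpace.single i (1 : ℝ) := by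
    intro h
    have := (EuclideanSpace.basisFun (Fin n) ℝ).sum_repr h
    simpa using this.symm
  rw [cl_symm (hessian_symm hφ x), cl_inner]
  conv_rhs => rw [e h, e k]
  simp only [map_sum, map_smul, sum_apply, smul_apply,
    smul_eq_mul]
  simp only [Finset.mul_sum, hessian_apply hφ]
  try rw [Finset.sum_comm]
  refine Finset.sum_congr rfl fun i _ => Finset.sum_congr rfl fun j _ => ?_
  ring

lemma taylor_two {φ : En n → ℝ} (hφ : ContDiff ℝ 2 φ) (x₀ : En n) :
    ∀ ε > 0, ∃ r > 0, ∀ h : En n, ‖h‖ < r →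
      φ (x₀ + h) ≤ φ x₀ + quadP 0 (gradient φ x₀) (hessianMatrix φ x₀) h + ε * ‖h‖ ^ 2 := by
  intro ε hε
  set X := hessianMatrix φ x₀
  set b := gradient φ x₀
  have hX : X.IsSymm := hessian_symm hφ x₀
  have hd : DifferentiableAt ℝ (fderiv ℝ φ) x₀ :=
    (hφ.fderiv_right (m := 1) (by norm_num)).differentiable (by norm_num) x₀
  have := (hasFDerivAt_iff_isLittleO_nhds_zero.1 hd.hasFDerivAt).def hε
  obtain ⟨r, hr, H⟩ := Metric.eventually_nhds_iff.1 this
  refine ⟨r, hr, fun h hh => ?_⟩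
  have hφd : Differentiable ℝ φ := hφ.differentiable (by norm_num)
  have key := (convex_closedBall (0 : En n) ‖h‖).norm_image_sub_le_of_norm_hasFDerivWithin_le
    (f := fun k => φ (x₀ + k) - quadP 0 b X k)
    (f' := fun k => fderiv ℝ φ (x₀ + k) - innerSL ℝ (b + cl X (k - 0))) (C := ε * ‖h‖)
    (x := 0) (y := h) (𝕜 := ℝ) (fun k _ => by
      apply HasFDerivAt.hasFDerivWithinAt
      refine HasFDerivAt.sub ?_ (quadP_hasFDerivAt 0 b hX k)
      exact (hφd (x₀ + k)).hasFDerivAt.comp k ((hasFDerivAt_id k).const_add x₀))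
    (fun k hk => by
      have hk' : ‖k‖ ≤ ‖h‖ := by simpa using hk
      have h1 := H (y := k) (by simpa using lt_of_le_of_lt hk' hh)
      have e : fderiv ℝ φ (x₀ + k) - innerSL ℝ (b + cl X (k - 0)) =
          fderiv ℝ φ (x₀ + k) - fderiv ℝ φ x₀ - fderiv ℝ (fderiv ℝ φ) x₀ k := by
        ext y
        have h2 : inner ℝ b y = fderiv ℝ φ x₀ y := by
          have := (hφd x₀).hasGradientAt
          rw [hasGradientAt_iff_hasFDerivAt] at this
          rw [this.fderiv]; simp [b]
        simp only [sub_zero, sub_apply, innerSL_apply_apply, inner_add_left]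
        rw [h2, hessian_cl hφ]; ring
      rw [e]
      exact h1.trans (by gcongr)) (by simp) (by simp)
  have h0 : quadP 0 b X 0 = 0 := by simp [quadP]
  simp only [add_zero, h0, sub_zero] at key
  have := (abs_le.1 (Real.norm_eq_abs _ ▸ key)).2
  nlinarith

end MatrixPart
section Jets
variable {n : ℕ} {lam Lam s : ℝ} {F : En n → Matrix (Fin n) (Fin n) ℝ → ℝ}
    {H : En n → En n → ℝ} {f u v : En n → ℝ}

lemma sub_jet (hLam : 0 < Lam)
    (hFell : ∀ (x : En n) (X Y : Matrix (Fin n) (Fin n) ℝ), X.IsSymm → Y.IsSymm →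
      Y.PosSemidef →
      lam * Y.trace ≤ F x (X + Y) - F x X ∧ F x (X + Y) - F x X ≤ Lam * Y.trace)
    (husub : ViscositySubsolution F H s f u) {x₀ b : En n} {X : Matrix (Fin n) (Fin n) ℝ}
    (hX : X.IsSymm)
    (hjet : ∀ ε > 0, ∃ r > 0, ∀ h : En n, ‖h‖ < r →
      u (x₀ + h) ≤ u x₀ + inner ℝ b h + inner ℝ (cl X h) h / 2 + ε * ‖h‖ ^ 2) :
    f x₀ ≤ F x₀ X + H x₀ b - |u x₀| ^ (s - 1) * u x₀ := by
  refine le_of_forall_pos_le_add fun δ hδ => ?_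
  set ε := δ / (2 * (Lam * n + 1)) with hε
  have hεpos : 0 < ε := by positivity
  obtain ⟨r, hr, hj⟩ := hjet ε hεpos
  have hsym : ((2 * ε) • (1 : Matrix (Fin n) (Fin n) ℝ)).IsSymm := Matrix.isSymm_one.smul _
  have hX' : (X + (2 * ε) • (1 : Matrix (Fin n) (Fin n) ℝ)).IsSymm := hX.add hsym
  have h1 := husub (quadP x₀ b (X + (2 * ε) • 1)) (quadP_contDiff _ _ _) x₀ (by
    refine Metric.eventually_nhds_iff.2 ⟨r, hr, fun y hy => ?_⟩
    have := hj (y - x₀) (by rwa [← dist_eq_norm])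
    rw [add_sub_cancel] at this
    simp only [Pi.sub_apply, quadP, cl_add, cl_smul, cl_one, sub_self, map_zero, inner_zero_right,
      add_apply, smul_apply, ContinuousLinearMap.id_apply, inner_add_left, inner_smul_left,
      real_inner_self_eq_norm_sq, conj_trivial]
    linarith)
  rw [quadP_hessian _ _ hX', quadP_gradient _ _ hX', sub_self, map_zero, add_zero] at h1
  have h2 := (hFell x₀ X ((2 * ε) • 1) hX hsym (Matrix.PosSemidef.one.smul (by positivity))).2
  have h3 : Lam * ((2 * ε) • (1 : Matrix (Fin n) (Fin n) ℝ)).trace ≤ δ := by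
    rw [Matrix.trace_smul, Matrix.trace_one, Fintype.card_fin, smul_eq_mul, hε]
    have : Lam * (2 * (δ / (2 * (Lam * n + 1))) * n) = δ * (Lam * n / (Lam * n + 1)) := by
      field_simp
    rw [this]
    have h4 : Lam * n / (Lam * n + 1) ≤ 1 := by
      rw [div_le_one (by positivity)]; linarith
    nlinarith
  linarith

lemma super_jet (hLam : 0 < Lam)
    (hFell : ∀ (x : En n) (X Y : Matrix (Fin n) (Fin n) ℝ), X.IsSymm → Y.IsSymm →
      Y.PosSemidef →
      lam * Y.trace ≤ F x (X + Y) - F x X ∧ F x (X + Y) - F x X ≤ Lam * Y.trace)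
    (hvsup : ViscositySupersolution F H s f v) {x₀ b : En n} {X : Matrix (Fin n) (Fin n) ℝ}
    (hX : X.IsSymm)
    (hjet : ∀ ε > 0, ∃ r > 0, ∀ h : En n, ‖h‖ < r →
      v x₀ + inner ℝ b h + inner ℝ (cl X h) h / 2 - ε * ‖h‖ ^ 2 ≤ v (x₀ + h)) :
    F x₀ X + H x₀ b - |v x₀| ^ (s - 1) * v x₀ ≤ f x₀ := by
  refine le_of_forall_pos_le_add fun δ hδ => ?_
  set ε := δ / (2 * (Lam * n + 1)) with hε
  have hεpos : 0 < ε := by positivity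
  obtain ⟨r, hr, hj⟩ := hjet ε hεpos
  have hsym : ((2 * ε) • (1 : Matrix (Fin n) (Fin n) ℝ)).IsSymm := Matrix.isSymm_one.smul _
  have hX' : (X - (2 * ε) • (1 : Matrix (Fin n) (Fin n) ℝ)).IsSymm := hX.sub hsym
  have h1 := hvsup (quadP x₀ b (X - (2 * ε) • 1)) (quadP_contDiff _ _ _) x₀ (by
    refine Metric.eventually_nhds_iff.2 ⟨r, hr, fun y hy => ?_⟩
    have := hj (y - x₀) (by rwa [← dist_eq_norm])
    rw [add_sub_cancel] at this
    obtain ⟨d, hd⟩ : ∃ d, d = y - x₀ := ⟨_, rfl⟩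
    simp only [Pi.sub_apply, quadP, ← hd] at this ⊢
    simp only [cl_sub, cl_smul, cl_one, sub_self, map_zero, inner_zero_right,
      sub_apply, smul_apply, ContinuousLinearMap.id_apply, inner_sub_left, inner_smul_left,
      real_inner_self_eq_norm_sq, conj_trivial]
    linarith)
  rw [quadP_hessian _ _ hX', quadP_gradient _ _ hX', sub_self, map_zero, add_zero] at h1
  have h2 := (hFell x₀ (X - (2 * ε) • 1) ((2 * ε) • 1) hX' hsym
    (Matrix.PosSemidef.one.smul (by positivity))).2
  rw [sub_add_cancel] at h2
  have h3 : Lam * ((2 * ε) • (1 : Matrix (Fin n) (Fin n) ℝ)).trace ≤ δ := by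
    rw [Matrix.trace_smul, Matrix.trace_one, Fintype.card_fin, smul_eq_mul, hε]
    have : Lam * (2 * (δ / (2 * (Lam * n + 1))) * n) = δ * (Lam * n / (Lam * n + 1)) := by
      field_simp
    rw [this]
    have h4 : Lam * n / (Lam * n + 1) ≤ 1 := by
      rw [div_le_one (by positivity)]; linarith
    nlinarith
  linarith

end Jets

section Pucci
variable {n : ℕ}
open Matrix

lemma spectral_real {Z : Matrix (Fin n) (Fin n) ℝ} (hZ : Z.IsSymm) :
    ∃ (U : Matrix (Fin n) (Fin n) ℝ) (d : Fin n → ℝ), Uᵀ * U = 1 ∧ U * Uᵀ = 1 ∧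
      Z = U * diagonal d * Uᵀ := by
  have hH : Z.IsHermitian := by
    rw [Matrix.IsHermitian, conjTranspose_eq_transpose_of_trivial]; exact hZ
  refine ⟨(hH.eigenvectorUnitary : Matrix (Fin n) (Fin n) ℝ), hH.eigenvalues, ?_, ?_, ?_⟩
  · have := Unitary.coe_star_mul_self hH.eigenvectorUnitary
    rwa [star_eq_conjTranspose, conjTranspose_eq_transpose_of_trivial] at this
  · have := Unitary.coe_mul_star_self hH.eigenvectorUnitary
    rwa [Unitary.coe_star, star_eq_conjTranspose, conjTranspose_eq_transpose_of_trivial] at this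
  · have := hH.spectral_theorem
    rw [Unitary.conjStarAlgAut_apply, star_eq_conjTranspose,
      conjTranspose_eq_transpose_of_trivial] at this
    exact this

lemma trace_diag_form (A U : Matrix (Fin n) (Fin n) ℝ) (d : Fin n → ℝ) :
    (A * (U * diagonal d * Uᵀ)).trace = ∑ i, (Uᵀ * A * U) i i * d i := by
  have e : (A * (U * diagonal d * Uᵀ)).trace = ((Uᵀ * A * U) * diagonal d).trace := by
    have e1 : A * (U * diagonal d * Uᵀ) = (A * U * diagonal d) * Uᵀ := by
      simp only [Matrix.mul_assoc]
    rw [e1, trace_mul_comm]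
    simp only [Matrix.mul_assoc]
  rw [e]
  simp [trace, mul_diagonal]

lemma conj_diag_bounds {lam Lam : ℝ} {A U : Matrix (Fin n) (Fin n) ℝ} (hU : Uᵀ * U = 1)
    (h1 : (A - lam • (1 : Matrix (Fin n) (Fin n) ℝ)).PosSemidef)
    (h2 : (Lam • (1 : Matrix (Fin n) (Fin n) ℝ) - A).PosSemidef) (i : Fin n) :
    lam ≤ (Uᵀ * A * U) i i ∧ (Uᵀ * A * U) i i ≤ Lam := by
  have g1 := (h1.conjTranspose_mul_mul_same U).diag_nonneg (i := i)
  have g2 := (h2.conjTranspose_mul_mul_same U).diag_nonneg (i := i)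
  rw [conjTranspose_eq_transpose_of_trivial] at g1 g2
  have e1 : Uᵀ * (A - lam • (1 : Matrix (Fin n) (Fin n) ℝ)) * U = Uᵀ * A * U - lam • 1 := by
    rw [Matrix.mul_sub, Matrix.sub_mul]; simp [hU]
  have e2 : Uᵀ * (Lam • (1 : Matrix (Fin n) (Fin n) ℝ) - A) * U = Lam • 1 - Uᵀ * A * U := by
    rw [Matrix.mul_sub, Matrix.sub_mul]; simp [hU]
  rw [e1] at g1
  rw [e2] at g2
  simp at g1 g2
  exact ⟨g1, g2⟩

lemma pucci_bdd {lam Lam : ℝ} (hlam : 0 < lam) {Z : Matrix (Fin n) (Fin n) ℝ} (hZ : Z.IsSymm) :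
    BddAbove ((fun A : Matrix (Fin n) (Fin n) ℝ => (A * Z).trace) ''
    {A | A.IsSymm ∧ (A - lam • (1 : Matrix (Fin n) (Fin n) ℝ)).PosSemidef ∧
      (Lam • (1 : Matrix (Fin n) (Fin n) ℝ) - A).PosSemidef}) := by
  obtain ⟨U, d, hU, -, rfl⟩ := spectral_real hZ
  refine ⟨∑ i, Lam * |d i|, ?_⟩
  rintro _ ⟨A, ⟨-, h1, h2⟩, rfl⟩
  simp only
  rw [trace_diag_form]
  refine Finset.sum_le_sum fun i _ => ?_
  obtain ⟨g1, g2⟩ := conj_diag_bounds hU h1 h2 i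
  calc _ ≤ (Uᵀ * A * U) i i * |d i| := by
        apply mul_le_mul_of_nonneg_left (le_abs_self _); linarith
    _ ≤ _ := by gcongr

lemma conj_posSemidef (U : Matrix (Fin n) (Fin n) ℝ) {d : Fin n → ℝ} (hd : ∀ i, 0 ≤ d i) :
    (U * diagonal d * Uᵀ).PosSemidef := by
  have := (PosSemidef.diagonal (n := Fin n) (R := ℝ) (d := d) hd).mul_mul_conjTranspose_same U
  rwa [conjTranspose_eq_transpose_of_trivial] at this

lemma conj_symm (U : Matrix (Fin n) (Fin n) ℝ) (d : Fin n → ℝ) :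
    (U * diagonal d * Uᵀ).IsSymm := by
  rw [Matrix.IsSymm]; simp [Matrix.mul_assoc]

lemma conj_trace {U : Matrix (Fin n) (Fin n) ℝ} (hU : Uᵀ * U = 1) (d : Fin n → ℝ) :
    (U * diagonal d * Uᵀ).trace = ∑ i, d i := by
  have := trace_diag_form 1 U d
  rw [Matrix.one_mul] at this
  rw [this]; simp [hU]

lemma F_le_pucci {lam Lam : ℝ} (hlam : 0 < lam) (hl : lam ≤ Lam)
    {Fx : Matrix (Fin n) (Fin n) ℝ → ℝ}
    (hFell : ∀ (X Y : Matrix (Fin n) (Fin n) ℝ), X.IsSymm → Y.IsSymm →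
      Y.PosSemidef →
      lam * Y.trace ≤ Fx (X + Y) - Fx X ∧ Fx (X + Y) - Fx X ≤ Lam * Y.trace)
    {X Z : Matrix (Fin n) (Fin n) ℝ} (hX : X.IsSymm) (hZ : Z.IsSymm) :
    Fx (X + Z) - Fx X ≤ pucci lam Lam Z := by
  have hbdd := pucci_bdd (Lam := Lam) hlam hZ
  obtain ⟨U, d, hU, hU', rfl⟩ := spectral_real hZ
  set c : Fin n → ℝ := fun i => if 0 ≤ d i then Lam else lam with hc
  set P := U * diagonal (fun i => max (d i) 0) * Uᵀ with hP
  set M := U * diagonal (fun i => max (-d i) 0) * Uᵀ with hM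
  have hPM : U * diagonal d * Uᵀ = P - M := by
    rw [hP, hM, ← Matrix.sub_mul, ← Matrix.mul_sub, diagonal_sub]
    congr 3
    ext i
    rcases le_total 0 (d i) with h | h
    · rw [max_eq_left h, max_eq_right (by linarith)]; ring
    · rw [max_eq_right h, max_eq_left (by linarith)]; ring
  have hPs : P.PosSemidef := conj_posSemidef U fun i => le_max_right _ _
  have hMs : M.PosSemidef := conj_posSemidef U fun i => le_max_right _ _
  have hXM : (X - M).IsSymm := hX.sub (conj_symm U _)
  have h1 := (hFell (X - M) P hXM (conj_symm U _) hPs).2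
  have h2 := (hFell (X - M) M hXM (conj_symm U _) hMs).1
  rw [sub_add_cancel] at h2
  have e : X + U * diagonal d * Uᵀ = X - M + P := by rw [hPM]; abel
  rw [e]
  have h3 : Fx (X - M + P) - Fx X ≤ Lam * P.trace - lam * M.trace := by linarith
  refine h3.trans ?_
  have hone : U * diagonal (fun _ => (1:ℝ)) * Uᵀ = 1 := by
    rw [diagonal_one, Matrix.mul_one, hU']
  have hmem := le_csSup hbdd (Set.mem_image_of_mem (fun A : Matrix (Fin n) (Fin n) ℝ => (A * (U * diagonal d * Uᵀ)).trace)
    (show U * diagonal c * Uᵀ ∈ {A | A.IsSymm ∧ (A - lam • (1 : Matrix (Fin n) (Fin n) ℝ)).PosSemidef ∧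
      (Lam • (1 : Matrix (Fin n) (Fin n) ℝ) - A).PosSemidef} from ⟨conj_symm U c, by
    have : U * diagonal c * Uᵀ - lam • (1 : Matrix (Fin n) (Fin n) ℝ) =
        U * diagonal (fun i => c i - lam) * Uᵀ := by
      rw [← diagonal_sub, Matrix.mul_sub, Matrix.sub_mul]
      congr 1
      rw [show (diagonal fun _ : Fin n => lam) = lam • diagonal (fun _ => (1:ℝ)) by
        rw [← diagonal_smul]; congr 1; ext; simp]
      rw [Matrix.mul_smul, Matrix.smul_mul, hone]
    rw [this]
    refine conj_posSemidef U fun i => ?_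
    simp only [hc]; split_ifs <;> linarith, by
    have : Lam • (1 : Matrix (Fin n) (Fin n) ℝ) - U * diagonal c * Uᵀ =
        U * diagonal (fun i => Lam - c i) * Uᵀ := by
      rw [← diagonal_sub, Matrix.mul_sub, Matrix.sub_mul]
      congr 1
      rw [show (diagonal fun _ : Fin n => Lam) = Lam • diagonal (fun _ => (1:ℝ)) by
        rw [← diagonal_smul]; congr 1; ext; simp]
      rw [Matrix.mul_smul, Matrix.smul_mul, hone]
    rw [this]
    refine conj_posSemidef U fun i => ?_
    simp only [hc]; split_ifs <;> linarith⟩))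
  refine le_trans (le_of_eq ?_) hmem
  rw [trace_diag_form, hP, hM, conj_trace hU, conj_trace hU, Finset.mul_sum, Finset.mul_sum,
    ← Finset.sum_sub_distrib]
  refine Finset.sum_congr rfl fun i _ => ?_
  have e2 : Uᵀ * (U * diagonal c * Uᵀ) * U = diagonal c := by
    calc _ = (Uᵀ * U) * diagonal c * (Uᵀ * U) := by simp only [Matrix.mul_assoc]
      _ = _ := by rw [hU]; simp
  rw [e2, diagonal_apply_eq]
  simp only [hc]
  split_ifs with h
  · rw [max_eq_left h, max_eq_right (by linarith)]; ring
  · rw [max_eq_right (by linarith), max_eq_left (by linarith)]; ring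

lemma pucci_add_smul {lam Lam : ℝ} (hlam : 0 < lam) (hl : lam ≤ Lam)
    {Z : Matrix (Fin n) (Fin n) ℝ} (hZ : Z.IsSymm) {c : ℝ} (hc : 0 ≤ c) :
    pucci lam Lam (Z + c • 1) ≤ pucci lam Lam Z + c * (Lam * n) := by
  unfold pucci
  apply csSup_le
  · refine Set.Nonempty.image _ ⟨lam • 1, Matrix.isSymm_one.smul _, ?_, ?_⟩
    · rw [sub_self]; exact PosSemidef.zero
    · rw [← sub_smul]; exact PosSemidef.one.smul (sub_nonneg.2 hl)
  · rintro _ ⟨A, hA, rfl⟩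
    have h1 := le_csSup (pucci_bdd (Lam := Lam) hlam hZ) (Set.mem_image_of_mem _ hA)
    have h2 := hA.2.2.trace_nonneg
    rw [trace_sub, trace_smul, trace_one, Fintype.card_fin, smul_eq_mul] at h2
    simp only [Matrix.mul_add, trace_add, Matrix.mul_smul, Matrix.mul_one, trace_smul,
      smul_eq_mul] at h1 ⊢
    nlinarith

end Pucci
section Sums
variable {E : Type*} [NormedAddCommGroup E] [InnerProductSpace ℝ E]

lemma conj_exists {K : Set E} (hK : IsCompact K) (hne : K.Nonempty) {φ : E → ℝ}
    (hφ : Continuous φ) (k : ℝ) (hk : 0 < k) :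
    ∃ (G : E → ℝ) (S : E → E) (R : ℝ), Continuous G ∧ (∀ x, S x ∈ K) ∧
      (∀ x, G x = φ (S x) + k * inner ℝ x (S x)) ∧
      (∀ x, ∀ ξ ∈ K, φ ξ + k * inner ℝ x ξ ≤ G x) ∧ (∀ x, k • S x ∈ SubG G x) ∧
      (∀ x, ‖k • S x‖ ≤ R) := by
  have h1 : ∀ x : E, ∃ ξ ∈ K, ∀ ξ' ∈ K, φ ξ' + k * inner ℝ x ξ' ≤ φ ξ + k * inner ℝ x ξ := by
    intro x
    have hc : Continuous fun ξ => φ ξ + k * inner ℝ x ξ := by fun_prop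
    obtain ⟨ξ, hξ, hmax⟩ := hK.exists_isMaxOn hne hc.continuousOn
    exact ⟨ξ, hξ, fun ξ' h => hmax h⟩
  choose S hS hmax using h1
  obtain ⟨R, hR⟩ := hK.isBounded.exists_norm_le
  have hsub : ∀ x, k • S x ∈ SubG (fun x => φ (S x) + k * inner ℝ x (S x)) x := by
    intro x y
    have := hmax y (S x) (hS x)
    simp only
    rw [inner_smul_left, inner_sub_right, real_inner_comm (S x) y, real_inner_comm (S x) x]
      at *
    simp only [conj_trivial]
    linarith
  have hbd : ∀ x, ‖k • S x‖ ≤ k * R := by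
    intro x
    rw [norm_smul, Real.norm_eq_abs, abs_of_pos hk]
    have := hR (S x) (hS x)
    gcongr
  refine ⟨fun x => φ (S x) + k * inner ℝ x (S x), S, k * R, ?_, hS, fun x => rfl,
    fun x ξ hξ => hmax x ξ hξ, hsub, hbd⟩
  have hR0 : 0 ≤ k * R := (norm_nonneg _).trans (hbd 0)
  refine (LipschitzWith.of_le_add_mul ⟨k * R, hR0⟩ ?_).continuous
  intro x y
  have h2 := hsub x y
  have h3 : -(‖k • S x‖ * ‖y - x‖) ≤ inner ℝ (k • S x) (y - x) :=
    (abs_le.1 (abs_real_inner_le_norm _ _)).1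
  have h4 := mul_le_mul_of_nonneg_right (hbd x) (norm_nonneg (y - x))
  simp only at h2
  change _ ≤ _ + k * R * dist x y
  rw [dist_comm, dist_eq_norm]
  linarith

lemma SubG.eq_of_touch {G : E → ℝ} {z a b : E} {C : ℝ} (hC : 0 < C) (ha : a ∈ SubG G z)
    (ht : ∀ h, G (z + h) ≤ G z + inner ℝ b h + C * ‖h‖ ^ 2) : a = b := by
  have h1 := ha (z + (2 * C)⁻¹ • (a - b))
  have h2 := ht ((2 * C)⁻¹ • (a - b))
  rw [add_sub_cancel_left, inner_smul_right] at h1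
  rw [inner_smul_right, norm_smul, mul_pow, Real.norm_eq_abs, sq_abs] at h2
  have h3 : (inner ℝ a (a - b) - inner ℝ b (a - b) : ℝ) = ‖a - b‖ ^ 2 := by
    rw [← inner_sub_left, real_inner_self_eq_norm_sq]
  have h4 : (2 * C)⁻¹ * ‖a - b‖ ^ 2 ≤ C * ((2 * C)⁻¹ ^ 2 * ‖a - b‖ ^ 2) := by
    rw [← h3, mul_sub]; rw [← h3] at h2; linarith
  have h5 : C * ((2 * C)⁻¹ ^ 2 * ‖a - b‖ ^ 2) = (2 * C)⁻¹ * ‖a - b‖ ^ 2 / 2 := by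
    field_simp; try ring
  rw [h5] at h4
  have h6 : 0 < (2 * C)⁻¹ := by positivity
  have h7 : ‖a - b‖ ^ 2 ≤ 0 := by
    by_contra! hcon
    have := mul_pos h6 hcon
    linarith
  have h8 : ‖a - b‖ = 0 := by
    have := sq_nonneg ‖a - b‖
    exact pow_eq_zero_iff (two_ne_zero) |>.1 (le_antisymm h7 this)
  exact sub_eq_zero.1 (norm_eq_zero.1 h8)

lemma sums_core [FiniteDimensional ℝ E] {G1 G2 : E → ℝ} (hc1 : Continuous G1)
    (hc2 : Continuous G2) {T1 T2 : E → E} (hT1 : ∀ x, T1 x ∈ SubG G1 x)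
    (hT2 : ∀ x, T2 x ∈ SubG G2 x) {R1 R2 : ℝ} (hR1 : ∀ x, ‖T1 x‖ ≤ R1) (hR2 : ∀ x, ‖T2 x‖ ≤ R2)
    {k ε : ℝ} (hk : 0 < k) (hε : 0 < ε) :
    ∃ q1 q2 x y : E, ‖q1‖ < ε ∧ ‖q2‖ < ε ∧
      (∀ x' y', G1 x' + G2 y' - k / 2 * (‖x'‖ ^ 2 + ‖y'‖ ^ 2 + ‖x' - y'‖ ^ 2)
          - inner ℝ q1 x' - inner ℝ q2 y' ≤
        G1 x + G2 y - k / 2 * (‖x‖ ^ 2 + ‖y‖ ^ 2 + ‖x - y‖ ^ 2)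
          - inner ℝ q1 x - inner ℝ q2 y) ∧
      T1 x = (2 * k) • x - k • y + q1 ∧ T2 y = (2 * k) • y - k • x + q2 ∧
      ∃ L1 L2 : E →L[ℝ] E,
        (∀ ε > 0, ∃ r > 0, ∀ h : E, ‖h‖ < r →
          |G1 (x + h) - G1 x - inner ℝ (T1 x) h - inner ℝ (L1 h) h / 2| ≤ ε * ‖h‖ ^ 2) ∧
        (∀ ε > 0, ∃ r > 0, ∀ h : E, ‖h‖ < r →
          |G2 (y + h) - G2 y - inner ℝ (T2 y) h - inner ℝ (L2 h) h / 2| ≤ ε * ‖h‖ ^ 2) := by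
  let W := WithLp 2 (E × E)
  let G : W → ℝ := fun z => G1 z.fst + G2 z.snd
  have hG : Continuous G := by fun_prop
  let T : W → W := fun z => WithLp.toLp 2 (T1 z.fst, T2 z.snd)
  have hinner : ∀ z w : W, inner ℝ z w = inner ℝ z.fst w.fst + inner ℝ z.snd w.snd :=
    fun z w => WithLp.prod_inner_apply _ _
  have hadd1 : ∀ z h : W, (z + h).fst = z.fst + h.fst := fun _ _ => rfl
  have hadd2 : ∀ z h : W, (z + h).snd = z.snd + h.snd := fun _ _ => rfl
  have hT : ∀ z, T z ∈ SubG G z := by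
    intro z y
    have h1 := hT1 z.fst y.fst
    have h2 := hT2 z.snd y.snd
    rw [hinner]
    change G1 z.fst + G2 z.snd + (inner ℝ (T1 z.fst) (y.fst - z.fst) +
      inner ℝ (T2 z.snd) (y.snd - z.snd)) ≤ G1 y.fst + G2 y.snd
    linarith
  let e := WithLp.prodContinuousLinearEquiv 2 ℝ E E
  let B0 : E × E →L[ℝ] E × E :=
    ((2 * k) • ContinuousLinearMap.fst ℝ E E - k • ContinuousLinearMap.snd ℝ E E).prod
    ((2 * k) • ContinuousLinearMap.snd ℝ E E - k • ContinuousLinearMap.fst ℝ E E)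
  let B : W →L[ℝ] W := (e.symm : E × E →L[ℝ] W).comp (B0.comp (e : W →L[ℝ] E × E))
  have hB1 : ∀ z, (B z).fst = (2 * k) • z.fst - k • z.snd := fun z => rfl
  have hB2 : ∀ z, (B z).snd = (2 * k) • z.snd - k • z.fst := fun z => rfl
  obtain ⟨q, hq, hJA⟩ := SubG.jensen_alexandrov hG (fun z => ⟨_, hT z⟩) B hε
  have hnorm : ∀ z : W, ‖z‖ ^ 2 = ‖z.fst‖ ^ 2 + ‖z.snd‖ ^ 2 := WithLp.prod_norm_sq_eq_of_L2
  let Ψ : W → ℝ := fun z => G z - k / 2 * (‖z.fst‖ ^ 2 + ‖z.snd‖ ^ 2 + ‖z.fst - z.snd‖ ^ 2)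
    - inner ℝ q z
  have hΨ : Continuous Ψ := by
    have h1 : Continuous fun z : W => z.fst := by fun_prop
    have h2 : Continuous fun z : W => z.snd := by fun_prop
    have h3 : Continuous fun z : W => (inner ℝ q z : ℝ) := by fun_prop
    exact (hG.sub (continuous_const.mul (((h1.norm.pow 2).add (h2.norm.pow 2)).add
      ((h1.sub h2).norm.pow 2)))).sub h3
  have hR1' : 0 ≤ R1 := (norm_nonneg _).trans (hR1 0)
  have hR2' : 0 ≤ R2 := (norm_nonneg _).trans (hR2 0)
  have hGb : ∀ z : W, G z ≤ G 0 + (R1 + R2) * ‖z‖ := by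
    intro z
    have h1 := hT z 0
    rw [zero_sub, inner_neg_right, hinner] at h1
    have hz1 : ‖z.fst‖ ≤ ‖z‖ := by
      have := hnorm z; nlinarith [norm_nonneg z, norm_nonneg z.fst, sq_nonneg ‖z.snd‖]
    have hz2 : ‖z.snd‖ ≤ ‖z‖ := by
      have := hnorm z; nlinarith [norm_nonneg z, norm_nonneg z.snd, sq_nonneg ‖z.fst‖]
    have h2 : inner ℝ (T1 z.fst) z.fst ≤ R1 * ‖z‖ := (real_inner_le_norm _ _).trans (by
      gcongr; exact hR1 _)
    have h3 : inner ℝ (T2 z.snd) z.snd ≤ R2 * ‖z‖ := (real_inner_le_norm _ _).trans (by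
      gcongr; exact hR2 _)
    change G z + -(inner ℝ (T1 z.fst) z.fst + inner ℝ (T2 z.snd) z.snd) ≤ G 0 at h1
    linarith
  have : FiniteDimensional ℝ W := inferInstance
  have : ProperSpace W := FiniteDimensional.proper ℝ W
  obtain ⟨z, hz⟩ := hΨ.exists_forall_ge' 0 (by
    filter_upwards [(tendsto_norm_cocompact_atTop (E := W)).eventually_ge_atTop
      (2 * (R1 + R2 + ‖q‖) / k)] with z hz
    rw [div_le_iff₀ hk] at hz
    have h1 := hGb z
    have h2 : -(‖q‖ * ‖z‖) ≤ inner ℝ q z := (abs_le.1 (abs_real_inner_le_norm _ _)).1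
    have h3 : Ψ 0 = G 0 := by simp [Ψ]
    rw [h3]
    simp only [Ψ]
    rw [← hnorm z]
    have h4 : 0 ≤ k / 2 * ‖z.fst - z.snd‖ ^ 2 := by positivity
    have h5 := norm_nonneg z
    have h6 := mul_le_mul_of_nonneg_right hz h5
    nlinarith)
  have htouch : ∀ h : W, G (z + h) ≤ G z + inner ℝ (B z + q) h + (2 * k) * ‖h‖ ^ 2 := by
    intro h
    have h1 := hz (z + h)
    simp only [Ψ] at h1
    rw [hadd1, hadd2] at h1
    have e0 : z.fst + h.fst - (z.snd + h.snd) = (z.fst - z.snd) + (h.fst - h.snd) := by abel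
    rw [e0, norm_add_sq_real, norm_add_sq_real, norm_add_sq_real (z.fst - z.snd)] at h1
    have e1 : inner ℝ (z.fst - z.snd) (h.fst - h.snd) = (inner ℝ z.fst h.fst - inner ℝ z.fst h.snd
      - inner ℝ z.snd h.fst + inner ℝ z.snd h.snd : ℝ) := by
      rw [inner_sub_left, inner_sub_right, inner_sub_right]; ring
    rw [inner_add_right, e1] at h1
    rw [inner_add_left, hinner (B z), hB1, hB2, inner_sub_left, inner_sub_left, inner_smul_left,
      inner_smul_left, inner_smul_left, inner_smul_left, hnorm h]
    simp only [conj_trivial]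
    have h2 : ‖h.fst - h.snd‖ ^ 2 ≤ 2 * (‖h.fst‖ ^ 2 + ‖h.snd‖ ^ 2) := by
      have := norm_sub_le h.fst h.snd
      nlinarith [norm_nonneg (h.fst - h.snd), sq_nonneg (‖h.fst‖ - ‖h.snd‖)]
    have h3 : 0 ≤ k * (‖h.fst‖ ^ 2 + ‖h.snd‖ ^ 2) := by positivity
    nlinarith
  have hTz : T z = B z + q := SubG.eq_of_touch (by positivity) (hT z) htouch
  obtain ⟨L, hL⟩ := hJA z (T z) (2 * k) (by positivity) (hT z) hTz (by rw [hTz]; exact htouch)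
  have hqn := hnorm q
  have hq1 : ‖q.fst‖ < ε := by
    refine lt_of_le_of_lt ?_ hq
    nlinarith [norm_nonneg q, norm_nonneg q.fst, sq_nonneg ‖q.snd‖]
  have hq2 : ‖q.snd‖ < ε := by
    refine lt_of_le_of_lt ?_ hq
    nlinarith [norm_nonneg q, norm_nonneg q.snd, sq_nonneg ‖q.fst‖]
  refine ⟨q.fst, q.snd, z.fst, z.snd, hq1, hq2, ?_, ?_, ?_, ?_⟩
  · intro x' y'
    have h1 := hz (WithLp.toLp 2 (x', y'))
    simp only [Ψ, hinner] at h1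
    change G1 x' + G2 y' - k / 2 * (‖x'‖ ^ 2 + ‖y'‖ ^ 2 + ‖x' - y'‖ ^ 2)
          - (inner ℝ q.fst x' + inner ℝ q.snd y') ≤ G1 z.fst + G2 z.snd - _ - _ at h1
    linarith
  · exact congrArg WithLp.fst hTz
  · exact congrArg WithLp.snd hTz
  · let L0 : E × E →L[ℝ] E × E := (e : W →L[ℝ] E × E).comp (L.comp (e.symm : E × E →L[ℝ] W))
    refine ⟨(ContinuousLinearMap.fst ℝ E E).comp (L0.comp (ContinuousLinearMap.inl ℝ E E)),
      (ContinuousLinearMap.snd ℝ E E).comp (L0.comp (ContinuousLinearMap.inr ℝ E E)), ?_, ?_⟩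
    · intro δ hδ
      obtain ⟨r, hr, H⟩ := hL δ hδ
      refine ⟨r, hr, fun h hh => ?_⟩
      have hn : ‖(WithLp.toLp 2 (h, 0) : W)‖ = ‖h‖ := by simp
      have := H (WithLp.toLp 2 (h, 0)) (by rwa [hn])
      rw [hn, hinner, hinner] at this
      change |G1 (z.fst + h) + G2 (z.snd + 0) - (G1 z.fst + G2 z.snd) -
        (inner ℝ (T1 z.fst) h + inner ℝ (T2 z.snd) 0) - (inner ℝ (L (WithLp.toLp 2 (h, 0))).fst h +
        inner ℝ (L (WithLp.toLp 2 (h, 0))).snd 0) / 2| ≤ _ at this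
      rw [inner_zero_right, inner_zero_right, add_zero, add_zero, add_zero] at this
      convert this using 2
      change _ - inner ℝ (L (WithLp.toLp 2 (h, 0))).fst h / 2 = _
      ring
    · intro δ hδ
      obtain ⟨r, hr, H⟩ := hL δ hδ
      refine ⟨r, hr, fun h hh => ?_⟩
      have hn : ‖(WithLp.toLp 2 (0, h) : W)‖ = ‖h‖ := by simp
      have := H (WithLp.toLp 2 (0, h)) (by rwa [hn])
      rw [hn, hinner, hinner] at this
      change |G1 (z.fst + 0) + G2 (z.snd + h) - (G1 z.fst + G2 z.snd) -
        (inner ℝ (T1 z.fst) 0 + inner ℝ (T2 z.snd) h) - (inner ℝ (L (WithLp.toLp 2 (0, h))).fst 0 +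
        inner ℝ (L (WithLp.toLp 2 (0, h))).snd h) / 2| ≤ _ at this
      rw [inner_zero_right, inner_zero_right, add_zero, zero_add, zero_add] at this
      convert this using 2
      change _ - inner ℝ (L (WithLp.toLp 2 (0, h))).snd h / 2 = _
      ring

end Sums
section Jets
variable {n : ℕ}

lemma exists_symm_cl (L : En n →L[ℝ] En n) : ∃ X : Matrix (Fin n) (Fin n) ℝ, X.IsSymm ∧
    ∀ h, inner ℝ (cl X h) h = inner ℝ (L h) h := by
  obtain ⟨M, hM⟩ : ∃ M : Matrix (Fin n) (Fin n) ℝ, cl M = L :=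
    (Matrix.toEuclideanCLM (n := Fin n) (𝕜 := ℝ)).surjective L
  have hMt : ∀ h : En n, inner ℝ (cl M.transpose h) h = inner ℝ (cl M h) h := by
    intro h
    rw [cl_inner, cl_inner, Finset.sum_comm]
    refine Finset.sum_congr rfl fun i _ => Finset.sum_congr rfl fun j _ => ?_
    rw [Matrix.transpose_apply]; ring
  refine ⟨(1 / 2 : ℝ) • (M + M.transpose), ?_, fun h => ?_⟩
  · unfold Matrix.IsSymm
    rw [Matrix.transpose_smul, Matrix.transpose_add, Matrix.transpose_transpose, add_comm]
  · rw [cl_smul, cl_add, smul_apply, add_apply,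
      inner_smul_left, inner_add_left, hMt, hM]
    simp only [conj_trivial]
    ring

lemma block_psd {P R S : Matrix (Fin n) (Fin n) ℝ} (hP : P.IsSymm) (hR : R.IsSymm)
    (hS : S.IsSymm) (H : ∀ h h' : En n, 0 ≤ inner ℝ (cl P h) h + inner ℝ (cl R h') h +
      inner ℝ (cl R h) h' + inner ℝ (cl S h') h') :
    (Matrix.fromBlocks P R R S).PosSemidef := by
  refine Matrix.PosSemidef.of_dotProduct_mulVec_nonneg ?_ fun z => ?_
  · rw [Matrix.isHermitian_fromBlocks_iff]
    have ht : ∀ M : Matrix (Fin n) (Fin n) ℝ, M.conjTranspose = M.transpose := fun M => by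
      ext; simp
    exact ⟨(ht P).trans hP, (ht R).trans hR, (ht R).trans hR, (ht S).trans hS⟩
  · have h1 := H (WithLp.toLp 2 (z ∘ Sum.inl)) (WithLp.toLp 2 (z ∘ Sum.inr))
    have hc : ∀ (X : Matrix (Fin n) (Fin n) ℝ) (a b : Fin n → ℝ),
        inner ℝ (cl X (WithLp.toLp 2 a)) (WithLp.toLp 2 b : En n) = b ⬝ᵥ (X.mulVec a) := by
      intro X a b
      rw [real_inner_comm, cl, Matrix.inner_toEuclideanCLM]
    rw [hc, hc, hc, hc] at h1
    rw [Matrix.fromBlocks_mulVec]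
    conv_rhs => rw [← Sum.elim_comp_inl_inr (star z)]
    rw [sumElim_dotProduct_sumElim, dotProduct_add, dotProduct_add]
    have e1 : star z ∘ Sum.inl = z ∘ Sum.inl := by ext; simp
    have e2 : star z ∘ Sum.inr = z ∘ Sum.inr := by ext; simp
    rw [e1, e2]
    linarith

lemma block_lower {X Y : Matrix (Fin n) (Fin n) ℝ} (hX : X.IsSymm) (hY : Y.IsSymm) {k : ℝ}
    (h1 : ∀ h : En n, -k * ‖h‖ ^ 2 ≤ inner ℝ (cl X h) h)
    (h2 : ∀ h : En n, -k * ‖h‖ ^ 2 ≤ inner ℝ (cl Y h) h) :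
    (Matrix.fromBlocks X 0 0 Y +
          k • (1 : Matrix (Fin n ⊕ Fin n) (Fin n ⊕ Fin n) ℝ)).PosSemidef := by
  rw [← Matrix.fromBlocks_one, Matrix.fromBlocks_smul, Matrix.fromBlocks_add, smul_zero, add_zero]
  have hs : (k • (1 : Matrix (Fin n) (Fin n) ℝ)).IsSymm := Matrix.isSymm_one.smul _
  refine block_psd (hX.add hs) Matrix.isSymm_zero (hY.add hs) fun h h' => ?_
  have := h1 h
  have := h2 h'
  have e0 : cl (0 : Matrix (Fin n) (Fin n) ℝ) = 0 := map_zero _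
  simp only [cl_add, cl_smul, cl_one, e0, add_apply, smul_apply, ContinuousLinearMap.id_apply,
    zero_apply, inner_add_left, inner_smul_left, conj_trivial, inner_zero_left,
    real_inner_self_eq_norm_sq]
  linarith

lemma block_upper {X Y : Matrix (Fin n) (Fin n) ℝ} (hX : X.IsSymm) (hY : Y.IsSymm) {k : ℝ}
    (h1 : ∀ h h' : En n, inner ℝ (cl X h) h + inner ℝ (cl Y h') h' ≤ k * ‖h - h'‖ ^ 2) :
    (k • Matrix.fromBlocks (1 : Matrix (Fin n) (Fin n) ℝ) (-1) (-1) 1 -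
          Matrix.fromBlocks X 0 0 Y).PosSemidef := by
  rw [Matrix.fromBlocks_smul, sub_eq_add_neg, Matrix.fromBlocks_neg, Matrix.fromBlocks_add,
    neg_zero, add_zero, ← sub_eq_add_neg, ← sub_eq_add_neg]
  have hs : (k • (1 : Matrix (Fin n) (Fin n) ℝ)).IsSymm := Matrix.isSymm_one.smul _
  refine block_psd (hs.sub hX) (Matrix.isSymm_one.neg.smul _) (hs.sub hY) fun h h' => ?_
  have := h1 h h'
  rw [norm_sub_sq_real] at this
  simp only [cl_sub, cl_neg, cl_smul, cl_one, sub_apply, smul_apply, ContinuousLinearMap.id_apply,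
    neg_apply, inner_sub_left, inner_neg_left, inner_smul_left, conj_trivial, 
    real_inner_self_eq_norm_sq]
  rw [real_inner_comm h h']
  linarith

lemma scale_le {a b c : ℝ} (hc : 0 ≤ c) (H : ∀ δ > 0, ∃ t : ℝ, 0 < t ∧
    t ^ 2 * a ≤ t ^ 2 * b + δ * (t ^ 2 * c)) : a ≤ b := by
  refine le_of_forall_pos_le_add fun e he => ?_
  obtain ⟨t, ht, h⟩ := H (e / (c + 1)) (by positivity)
  have ht2 : 0 < t ^ 2 := by positivity
  have h1 : e / (c + 1) * c ≤ e := by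
    rw [div_mul_eq_mul_div, div_le_iff₀ (by positivity)]
    nlinarith
  have h2 : t ^ 2 * a ≤ t ^ 2 * (b + e / (c + 1) * c) := by linarith
  have h3 := le_of_mul_le_mul_left h2 ht2
  linarith

lemma exists_scale (h h' : En n) {r : ℝ} (hr : 0 < r) : ∃ t : ℝ, 0 < t ∧ ‖t • h‖ < r ∧
    ‖t • h'‖ < r := by
  refine ⟨r / (‖h‖ + ‖h'‖ + 1), by positivity, ?_, ?_⟩ <;>
  · rw [norm_smul, Real.norm_eq_abs, abs_of_pos (by positivity), div_mul_eq_mul_div,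
      div_lt_iff₀ (by positivity)]
    have := norm_nonneg h
    have := norm_nonneg h'
    nlinarith

lemma conj_identity (k a : ℝ) (x ξ : En n) :
    a - k / 2 * ‖ξ‖ ^ 2 + k * inner ℝ x ξ = a - k / 2 * ‖x - ξ‖ ^ 2 + k / 2 * ‖x‖ ^ 2 := by
  rw [norm_sub_sq_real]; ring

/-- Jet transfer for one function. -/
lemma jet_transfer {K : Set (En n)} {u1 G : En n → ℝ} {S : En n → En n} {k : ℝ}
    (hG : ∀ x, G x = (u1 (S x) - k / 2 * ‖S x‖ ^ 2) + k * inner ℝ x (S x))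
    (hle : ∀ x, ∀ ξ ∈ K, (u1 ξ - k / 2 * ‖ξ‖ ^ 2) + k * inner ℝ x ξ ≤ G x) {x : En n}
    {L : En n →L[ℝ] En n} (hL : ∀ ε > 0, ∃ r > 0, ∀ h : En n, ‖h‖ < r →
          |G (x + h) - G x - inner ℝ (k • S x) h - inner ℝ (L h) h / 2| ≤ ε * ‖h‖ ^ 2) :
    ∀ ε > 0, ∃ r > 0, ∀ h : En n, ‖h‖ < r → S x + h ∈ K →
      u1 (S x + h) ≤ u1 (S x) + inner ℝ (k • (S x - x)) h +
        (inner ℝ (L h) h - k * ‖h‖ ^ 2) / 2 + ε * ‖h‖ ^ 2 := by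
  intro ε hε
  obtain ⟨r, hr, H⟩ := hL ε hε
  refine ⟨r, hr, fun h hh hK => ?_⟩
  have h1 := (abs_le.1 (H h hh)).2
  have h2 := hle (x + h) _ hK
  rw [conj_identity, add_sub_add_right_eq_sub, norm_add_sq_real] at h2
  have h3 := hG x
  rw [conj_identity] at h3
  rw [inner_smul_left] at h1 ⊢
  rw [inner_sub_left]
  simp only [conj_trivial] at *
  linarith

lemma sums {K : Set (En n)} (hK : IsCompact K) (hne : K.Nonempty) {u1 v1 : En n → ℝ}
    (hu : Continuous u1) (hv : Continuous v1) {k ε : ℝ} (hk : 0 < k) (hε : 0 < ε) :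
    ∃ (q1 q2 x y ξ η : En n) (X Y : Matrix (Fin n) (Fin n) ℝ), ‖q1‖ < ε ∧ ‖q2‖ < ε ∧
      ξ ∈ K ∧ η ∈ K ∧ X.IsSymm ∧ Y.IsSymm ∧
      k • (ξ - x) = k • (x - y) + q1 ∧ k • (η - y) = k • (y - x) + q2 ∧
      (∀ a ∈ K, ∀ b ∈ K, ∀ x' y', u1 a + v1 b - k / 2 * (‖x' - a‖ ^ 2 + ‖y' - b‖ ^ 2 +
          ‖x' - y'‖ ^ 2) - inner ℝ q1 x' - inner ℝ q2 y' ≤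
        u1 ξ + v1 η - k / 2 * (‖x - ξ‖ ^ 2 + ‖y - η‖ ^ 2 +
          ‖x - y‖ ^ 2) - inner ℝ q1 x - inner ℝ q2 y) ∧
      (∀ ε > 0, ∃ r > 0, ∀ h : En n, ‖h‖ < r → ξ + h ∈ K →
        u1 (ξ + h) ≤ u1 ξ + inner ℝ (k • (x - y) + q1) h + inner ℝ (cl X h) h / 2
          + ε * ‖h‖ ^ 2) ∧
      (∀ ε > 0, ∃ r > 0, ∀ h : En n, ‖h‖ < r → η + h ∈ K →
        v1 (η + h) ≤ v1 η + inner ℝ (k • (y - x) + q2) h + inner ℝ (cl Y h) h / 2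
          + ε * ‖h‖ ^ 2) ∧
      (∀ h : En n, -k * ‖h‖ ^ 2 ≤ inner ℝ (cl X h) h) ∧
      (∀ h : En n, -k * ‖h‖ ^ 2 ≤ inner ℝ (cl Y h) h) ∧
      (∀ h h' : En n, inner ℝ (cl X h) h + inner ℝ (cl Y h') h' ≤ k * ‖h - h'‖ ^ 2) := by
  obtain ⟨G1, S1, R1, hc1, hS1, hG1, hle1, hsub1, hR1⟩ := conj_exists hK hne
    (φ := fun ξ => u1 ξ - k / 2 * ‖ξ‖ ^ 2) (by fun_prop) k hk
  obtain ⟨G2, S2, R2, hc2, hS2, hG2, hle2, hsub2, hR2⟩ := conj_exists hK hne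
    (φ := fun ξ => v1 ξ - k / 2 * ‖ξ‖ ^ 2) (by fun_prop) k hk
  obtain ⟨q1, q2, x, y, hq1, hq2, hmax, hT1, hT2, L1, L2, hL1, hL2⟩ :=
    sums_core hc1 hc2 hsub1 hsub2 hR1 hR2 hk hε
  obtain ⟨X, hX, hXL⟩ := exists_symm_cl L1
  obtain ⟨Y, hY, hYL⟩ := exists_symm_cl L2
  have hs : (k • (1 : Matrix (Fin n) (Fin n) ℝ)).IsSymm := Matrix.isSymm_one.smul _
  have e1 : k • (S1 x - x) = k • (x - y) + q1 := by
    rw [smul_sub, hT1, smul_sub, two_mul, add_smul]; abel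
  have e2 : k • (S2 y - y) = k • (y - x) + q2 := by
    rw [smul_sub, hT2, smul_sub, two_mul, add_smul]; abel
  have hXq : ∀ h : En n, inner ℝ (cl (X - k • (1 : Matrix (Fin n) (Fin n) ℝ)) h) h =
      inner ℝ (L1 h) h - k * ‖h‖ ^ 2 := by
    intro h
    simp only [cl_sub, cl_smul, cl_one, sub_apply, smul_apply, ContinuousLinearMap.id_apply,
      inner_sub_left, inner_smul_left, conj_trivial, real_inner_self_eq_norm_sq, hXL]
  have hYq : ∀ h : En n, inner ℝ (cl (Y - k • (1 : Matrix (Fin n) (Fin n) ℝ)) h) h =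
      inner ℝ (L2 h) h - k * ‖h‖ ^ 2 := by
    intro h
    simp only [cl_sub, cl_smul, cl_one, sub_apply, smul_apply, ContinuousLinearMap.id_apply,
      inner_sub_left, inner_smul_left, conj_trivial, real_inner_self_eq_norm_sq, hYL]
  have hsc : ∀ (L : En n →L[ℝ] En n) (t : ℝ) (h : En n),
      inner ℝ (L (t • h)) (t • h) = t ^ 2 * inner ℝ (L h) h := by
    intro L t h
    rw [map_smul, inner_smul_left, inner_smul_right]; simp only [conj_trivial]; ring
  have hsn : ∀ (t : ℝ) (h : En n), ‖t • h‖ ^ 2 = t ^ 2 * ‖h‖ ^ 2 := by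
    intro t h; rw [norm_smul, mul_pow, Real.norm_eq_abs, sq_abs]
  have hlow : ∀ {G : En n → ℝ} {T x : En n} {L : En n →L[ℝ] En n}, T ∈ SubG G x →
      (∀ ε > 0, ∃ r > 0, ∀ h : En n, ‖h‖ < r →
          |G (x + h) - G x - inner ℝ T h - inner ℝ (L h) h / 2| ≤ ε * ‖h‖ ^ 2) →
      ∀ h : En n, 0 ≤ inner ℝ (L h) h / 2 := by
    intro G T x L hT hL h
    refine scale_le (sq_nonneg ‖h‖) fun δ hδ => ?_
    obtain ⟨r, hr, H⟩ := hL δ hδ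
    obtain ⟨t, ht, h1, -⟩ := exists_scale h h hr
    refine ⟨t, ht, ?_⟩
    have h2 := (abs_le.1 (H _ h1)).2
    have h3 := hT (x + t • h)
    rw [add_sub_cancel_left] at h3
    rw [hsn, hsc] at h2
    linarith
  refine ⟨q1, q2, x, y, S1 x, S2 y, X - k • 1, Y - k • 1, hq1, hq2, hS1 x, hS2 y,
    hX.sub hs, hY.sub hs, e1, e2, ?_, ?_, ?_, ?_, ?_, ?_⟩
  · intro a ha b hb x' y'
    have h1 := hle1 x' a ha
    have h2 := hle2 y' b hb
    have h3 := hmax x' y'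
    rw [hG1 x, hG2 y] at h3
    simp only [conj_identity] at h1 h2 h3
    linarith
  · intro δ hδ
    obtain ⟨r, hr, H⟩ := jet_transfer hG1 hle1 hL1 δ hδ
    refine ⟨r, hr, fun h hh hK => ?_⟩
    have := H h hh hK
    rw [e1] at this
    rw [hXq]; exact this
  · intro δ hδ
    obtain ⟨r, hr, H⟩ := jet_transfer hG2 hle2 hL2 δ hδ
    refine ⟨r, hr, fun h hh hK => ?_⟩
    have := H h hh hK
    rw [e2] at this
    rw [hYq]; exact this
  · intro h
    have := hlow (hsub1 x) hL1 h
    rw [hXq]; linarith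
  · intro h
    have := hlow (hsub2 y) hL2 h
    rw [hYq]; linarith
  · intro h h'
    rw [hXq, hYq]
    suffices hh : inner ℝ (L1 h) h / 2 + inner ℝ (L2 h') h' / 2 ≤
      k / 2 * (‖h‖ ^ 2 + ‖h'‖ ^ 2 + ‖h - h'‖ ^ 2) by linarith
    refine scale_le (c := ‖h‖ ^ 2 + ‖h'‖ ^ 2) (by positivity) fun δ hδ => ?_
    obtain ⟨r1, hr1, H1⟩ := hL1 δ hδ
    obtain ⟨r2, hr2, H2⟩ := hL2 δ hδ
    obtain ⟨t, ht, ht1, ht2⟩ := exists_scale h h' (lt_min hr1 hr2)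
    refine ⟨t, ht, ?_⟩
    have h1 := (abs_le.1 (H1 _ (ht1.trans_le (min_le_left _ _)))).1
    have h2 := (abs_le.1 (H2 _ (ht2.trans_le (min_le_right _ _)))).1
    have h3 := hmax (x + t • h) (y + t • h')
    have e0 : x + t • h - (y + t • h') = (x - y) + t • (h - h') := by rw [smul_sub]; abel
    rw [e0, norm_add_sq_real, norm_add_sq_real, norm_add_sq_real (x - y)] at h3
    rw [hT1] at h1
    rw [hT2] at h2
    rw [hsn, hsc] at h1 h2
    simp only [hsn, inner_add_left, inner_add_right, inner_sub_left, inner_sub_right,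
      inner_smul_left, inner_smul_right, conj_trivial] at h1 h2 h3
    linarith

end Jets
section Limit
variable {n : ℕ}
open Filter Topology

lemma young_weighted {m γ c t q : ℝ} (hm : 1 < m) (hγ : 0 < γ) (hc : 0 < c) (ht : 0 ≤ t)
    (hq : 0 ≤ q) : γ * t ^ (m - 1) * q ≤ c * t ^ m +
      (m - 1) ^ (m - 1) * γ ^ m * q ^ m / (m ^ m * c ^ (m - 1)) := by
  have hm1 : 0 < m - 1 := by linarith
  have hm0 : 0 < m := by linarith
  set β := c * m / (m - 1) with hβ
  have hβ0 : 0 < β := by positivity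
  set α := β ^ ((m - 1) / m) with hα
  have hα0 : 0 < α := rpow_pos_of_pos hβ0 _
  have hpq : (m / (m - 1)).HolderConjugate m := by
    refine (Real.holderConjugate_iff).2 ⟨?_, ?_⟩
    · rw [lt_div_iff₀ hm1]; linarith
    · field_simp; ring
  have hy := Real.young_inequality_of_nonneg (a := α * t ^ (m - 1)) (b := γ * q / α)
    (by positivity) (by positivity) hpq
  have e1 : α * t ^ (m - 1) * (γ * q / α) = γ * t ^ (m - 1) * q := by field_simp
  have e2 : (α * t ^ (m - 1)) ^ (m / (m - 1)) = β * t ^ m := by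
    rw [mul_rpow hα0.le (by positivity), hα, ← rpow_mul hβ0.le, ← rpow_mul ht]
    have : (m - 1) / m * (m / (m - 1)) = 1 := by field_simp
    rw [this, rpow_one]
    congr 2
    field_simp
  have e3 : (γ * q / α) ^ m = γ ^ m * q ^ m / β ^ (m - 1) := by
    rw [div_rpow (by positivity) hα0.le, mul_rpow hγ.le hq, hα, ← rpow_mul hβ0.le]
    congr 2
    field_simp
  have e4 : β ^ (m - 1) = c ^ (m - 1) * m ^ (m - 1) / (m - 1) ^ (m - 1) := by
    rw [hβ, div_rpow (by positivity) hm1.le, mul_rpow hc.le hm0.le]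
  have e5 : m ^ m = m ^ (m - 1) * m := by
    rw [← rpow_add_one hm0.ne']; congr 1; ring
  rw [e1, e2, e3, e4] at hy
  refine hy.trans (le_of_eq ?_)
  rw [e5]
  have h1 : 0 < (m - 1) ^ (m - 1) := rpow_pos_of_pos hm1 _
  have h2 : 0 < m ^ (m - 1) := rpow_pos_of_pos hm0 _
  have h3 : 0 < c ^ (m - 1) := rpow_pos_of_pos hc _
  rw [hβ]
  field_simp

lemma quadP_add (x₀ b : En n) {Z : Matrix (Fin n) (Fin n) ℝ} (hZ : Z.IsSymm) (x h : En n) :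
    quadP x₀ b Z (x + h) = quadP x₀ b Z x + inner ℝ (b + cl Z (x - x₀)) h +
      inner ℝ (cl Z h) h / 2 := by
  unfold quadP
  have e : x + h - x₀ = (x - x₀) + h := by abel
  rw [e, map_add]
  simp only [inner_add_left, inner_add_right]
  rw [cl_symm hZ h (x - x₀)]
  ring

lemma penal_limit {x₀ : En n} {ρ e0 : ℝ} (hρ : 0 < ρ) (he0 : 0 < e0) {u1 v1 : En n → ℝ}
    (hv : Continuous v1)
    (hmax : ∀ a ∈ Metric.closedBall x₀ ρ, u1 a + v1 a ≤ u1 x₀ + v1 x₀ - e0 * ‖a - x₀‖ ^ 2)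
    {q1 q2 x y ξ η : ℕ → En n}
    (hq1 : ∀ N : ℕ, ‖q1 N‖ < 1 / ((N : ℝ) + 1)) (hq2 : ∀ N : ℕ, ‖q2 N‖ < 1 / ((N : ℝ) + 1))
    (hξ : ∀ N, ξ N ∈ Metric.closedBall x₀ ρ) (hη : ∀ N, η N ∈ Metric.closedBall x₀ ρ)
    (H : ∀ N : ℕ, u1 x₀ + v1 x₀ - inner ℝ (q1 N) x₀ - inner ℝ (q2 N) x₀ ≤
        u1 (ξ N) + v1 (η N) - ((N : ℝ) + 1) / 2 * (‖x N - ξ N‖ ^ 2 + ‖y N - η N‖ ^ 2 +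
          ‖x N - y N‖ ^ 2) - inner ℝ (q1 N) (x N) - inner ℝ (q2 N) (y N)) :
    Tendsto ξ atTop (𝓝 x₀) ∧ Tendsto η atTop (𝓝 x₀) ∧
      Tendsto (fun N : ℕ => ((N : ℝ) + 1) * ‖ξ N - η N‖ ^ 2) atTop (𝓝 0) := by
  set D : ℕ → ℝ := fun N => ‖x N - ξ N‖ ^ 2 + ‖y N - η N‖ ^ 2 + ‖x N - y N‖ ^ 2 with hD
  have hD0 : ∀ N, 0 ≤ D N := fun N => by positivity
  have hb : ∀ N, ‖ξ N - η N‖ ^ 2 ≤ 3 * D N := by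
    intro N
    have e : ξ N - η N = -(x N - ξ N) + (x N - y N) + (y N - η N) := by abel
    have h1 : ‖ξ N - η N‖ ≤ ‖x N - ξ N‖ + ‖x N - y N‖ + ‖y N - η N‖ := by
      rw [e]
      refine (norm_add_le _ _).trans (add_le_add_left ((norm_add_le _ _).trans ?_) _)
      rw [norm_neg]
    have h2 := pow_le_pow_left₀ (norm_nonneg _) h1 2
    simp only [hD]
    nlinarith [sq_nonneg (‖x N - ξ N‖ - ‖x N - y N‖), sq_nonneg (‖x N - ξ N‖ - ‖y N - η N‖),
      sq_nonneg (‖x N - y N‖ - ‖y N - η N‖)]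
  have hqb : ∀ {q z ζ : En n} {ε d : ℝ}, ‖q‖ < ε → ζ ∈ Metric.closedBall x₀ ρ →
      ‖z - ζ‖ ^ 2 ≤ d → inner ℝ q x₀ - inner ℝ q z ≤ ε * (ρ + 1 + d) := by
    intro q z ζ ε d hq hζ hd
    rw [mem_closedBall_iff_norm] at hζ
    have h1 : ‖x₀ - z‖ ≤ ρ + 1 + d := by
      have : x₀ - z = -(ζ - x₀) - (z - ζ) := by abel
      have h2 : ‖x₀ - z‖ ≤ ‖ζ - x₀‖ + ‖z - ζ‖ := by
        rw [this]; refine (norm_sub_le _ _).trans ?_; rw [norm_neg]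
      nlinarith [norm_nonneg (z - ζ), sq_nonneg (‖z - ζ‖ - 1)]
    rw [← inner_sub_right]
    refine (real_inner_le_norm _ _).trans ?_
    exact mul_le_mul hq.le h1 (norm_nonneg _) ((norm_nonneg q).trans hq.le)
  have hstar : ∀ N : ℕ, ((N : ℝ) + 1) / 2 * D N + e0 * ‖ξ N - x₀‖ ^ 2 ≤
      (v1 (η N) - v1 (ξ N)) + 2 * (1 / ((N : ℝ) + 1) * (ρ + 1 + D N)) := by
    intro N
    have h1 := hmax _ (hξ N)
    have h2 := H N
    have h3 := hqb (hq1 N) (hξ N) (z := x N) (d := D N) (by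
      simp only [hD]; nlinarith [sq_nonneg ‖y N - η N‖, sq_nonneg ‖x N - y N‖])
    have h4 := hqb (hq2 N) (hη N) (z := y N) (d := D N) (by
      simp only [hD]; nlinarith [sq_nonneg ‖x N - ξ N‖, sq_nonneg ‖x N - y N‖])
    change _ ≤ u1 (ξ N) + v1 (η N) - ((N : ℝ) + 1) / 2 * D N - _ - _ at h2
    linarith
  have hKc : IsCompact (Metric.closedBall x₀ ρ) := isCompact_closedBall x₀ ρ
  obtain ⟨C, hC⟩ := hKc.exists_bound_of_continuousOn hv.continuousOn
  have hinv : Tendsto (fun N : ℕ => 1 / ((N : ℝ) + 1)) atTop (𝓝 0) :=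
    tendsto_one_div_add_atTop_nhds_zero_nat
  have hDlim : Tendsto D atTop (𝓝 0) := by
    have hlim : Tendsto (fun N : ℕ => (8 * C + 8 * (ρ + 1)) * (1 / ((N : ℝ) + 1))) atTop (𝓝 0) := by
      simpa using hinv.const_mul (8 * C + 8 * (ρ + 1))
    refine tendsto_of_tendsto_of_tendsto_of_le_of_le' tendsto_const_nhds hlim
      (Eventually.of_forall hD0) ?_
    filter_upwards [eventually_ge_atTop 3] with N hN
    have hN' : (3 : ℝ) ≤ N := by exact_mod_cast hN
    have h1 := hstar N
    have h2 := hC _ (hξ N)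
    have h3 := hC _ (hη N)
    rw [Real.norm_eq_abs, abs_le] at h2 h3
    have h4 : 0 ≤ e0 * ‖ξ N - x₀‖ ^ 2 := by positivity
    have h5 : 1 / ((N : ℝ) + 1) ≤ 1 / 4 := by
      apply one_div_le_one_div_of_le <;> linarith
    have h6 : 0 ≤ D N := hD0 N
    have h7 := mul_le_mul_of_nonneg_right h5 (show 0 ≤ ρ + 1 + D N by positivity)
    rw [mul_one_div, le_div_iff₀ (by positivity)]
    nlinarith
  have hd0 : Tendsto (fun N => ‖ξ N - η N‖ ^ 2) atTop (𝓝 0) := by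
    have : Tendsto (fun N => 3 * D N) atTop (𝓝 0) := by simpa using hDlim.const_mul 3
    exact squeeze_zero (fun N => sq_nonneg _) hb this
  have hdiff : Tendsto (fun N => ‖ξ N - η N‖) atTop (𝓝 0) := by
    have := hd0.sqrt
    simpa [Real.sqrt_sq (norm_nonneg _)] using this
  have hvd : Tendsto (fun N => v1 (η N) - v1 (ξ N)) atTop (𝓝 0) := by
    have huc := Metric.uniformContinuousOn_iff.1
      (hKc.uniformContinuousOn_of_continuous hv.continuousOn)
    rw [Metric.tendsto_atTop]
    intro ε hε
    obtain ⟨δ, hδ, h1⟩ := huc ε hε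
    obtain ⟨N0, h2⟩ := (Metric.tendsto_atTop.1 hdiff) δ hδ
    refine ⟨N0, fun N hN => ?_⟩
    have h3 := h2 N hN
    rw [Real.dist_0_eq_abs, abs_norm, ← dist_eq_norm, dist_comm] at h3
    have h4 := h1 _ (hη N) _ (hξ N) h3
    rwa [Real.dist_0_eq_abs, ← Real.dist_eq]
  have hrhs : Tendsto (fun N : ℕ => (v1 (η N) - v1 (ξ N)) +
      2 * (1 / ((N : ℝ) + 1) * (ρ + 1 + D N))) atTop (𝓝 0) := by
    have := hvd.add ((hinv.mul (hDlim.const_add (ρ + 1))).const_mul 2)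
    simpa using this
  have hξl : Tendsto ξ atTop (𝓝 x₀) := by
    rw [tendsto_iff_norm_sub_tendsto_zero]
    have h1 : Tendsto (fun N => ‖ξ N - x₀‖ ^ 2) atTop (𝓝 0) := by
      have h2 := hrhs.const_mul e0⁻¹
      rw [mul_zero] at h2
      refine squeeze_zero (fun N => sq_nonneg _) (fun N => ?_) h2
      rw [← div_eq_inv_mul, le_div_iff₀ he0]
      have := hstar N
      have : 0 ≤ ((N : ℝ) + 1) / 2 * D N := mul_nonneg (by positivity) (hD0 N)
      linarith
    have := h1.sqrt
    simpa [Real.sqrt_sq (norm_nonneg _)] using this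
  refine ⟨hξl, ?_, ?_⟩
  · have h1 : Tendsto (fun N => ξ N - η N) atTop (𝓝 0) := tendsto_zero_iff_norm_tendsto_zero.2 hdiff
    simpa using hξl.sub h1
  · have h2 := hrhs.const_mul 6
    rw [mul_zero] at h2
    refine squeeze_zero (fun N => by positivity) (fun N => ?_) h2
    have h3 := hstar N
    have h4 : 0 ≤ e0 * ‖ξ N - x₀‖ ^ 2 := by positivity
    have h5 := mul_le_mul_of_nonneg_left (hb N) (show (0 : ℝ) ≤ (N : ℝ) + 1 by positivity)
    linarith

end Limit
section Final
variable {n : ℕ}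
open Filter Topology

/-- The inequality at one level of penalization. -/
lemma level_ineq {lam Lam m s γ₁ γm cbar A σ₀ : ℝ} {ω ωR : ℝ → ℝ}
    {F : En n → Matrix (Fin n) (Fin n) ℝ → ℝ}
    {H : En n → En n → ℝ} {f u v : En n → ℝ} {R : ℝ}
    (hlam : 0 < lam) (hlamLam : lam ≤ Lam) (hm : 1 < m)
    (hFell : ∀ (x : En n) (X Y : Matrix (Fin n) (Fin n) ℝ), X.IsSymm → Y.IsSymm →
      Y.PosSemidef →
      lam * Y.trace ≤ F x (X + Y) - F x X ∧ F x (X + Y) - F x X ≤ Lam * Y.trace)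
    (hFstruct : ∀ ε > (0 : ℝ), ∀ (x y : En n) (X Y : Matrix (Fin n) (Fin n) ℝ),
        ‖x‖ < R → ‖y‖ < R → X.IsSymm → Y.IsSymm →
        (Matrix.fromBlocks X 0 0 (-Y) +
          (3 / ε) • (1 : Matrix (Fin n ⊕ Fin n) (Fin n ⊕ Fin n) ℝ)).PosSemidef →
        ((3 / ε) • Matrix.fromBlocks (1 : Matrix (Fin n) (Fin n) ℝ) (-1) (-1) 1 -
          Matrix.fromBlocks X 0 0 (-Y)).PosSemidef →
        F x X - F y Y ≤ ωR (‖x - y‖ + ε⁻¹ * ‖x - y‖ ^ 2))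
    (hFhom : ∀ σ ∈ Set.Ioo (0 : ℝ) 1, ∀ (x : En n) (X : Matrix (Fin n) (Fin n) ℝ),
      F x (σ • X) = σ * F x X)
    (hγm : 0 < γm)
    (hHstruct : ∀ x y p q : En n,
      |H x (p + q) - H y p| ≤ ω ‖x - y‖ * (‖p‖ ^ m + 1) +
        (γ₁ + γm * (‖p‖ ^ (m - 1) + ‖q‖ ^ (m - 1))) * ‖q‖)
    (hσ₀ : σ₀ ∈ Set.Ioo (0 : ℝ) 1)
    (hHconv : ∀ (x p : En n), ∀ σ ∈ Set.Ioo σ₀ 1,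
      H x p - σ * H x (σ⁻¹ • p) ≤ (1 - σ) * (-cbar * ‖p‖ ^ m + A))
    (husub : ViscositySubsolution F H s f u)
    (hvsup : ViscositySupersolution F H s f v)
    {σ : ℝ} (hσ : σ ∈ Set.Ioo σ₀ 1) {x₀ b : En n} {Z : Matrix (Fin n) (Fin n) ℝ} (hZ : Z.IsSymm)
    {K : Set (En n)} {ξ η d q1 q2 : En n} {X Y : Matrix (Fin n) (Fin n) ℝ} {k : ℝ} (hk : 0 < k)
    (hX : X.IsSymm) (hY : Y.IsSymm) (hξK : K ∈ 𝓝 ξ) (hηK : K ∈ 𝓝 η)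
    (hξR : ‖ξ‖ < R) (hηR : ‖η‖ < R)
    (hju : ∀ ε > 0, ∃ r > 0, ∀ h : En n, ‖h‖ < r → ξ + h ∈ K →
        u (ξ + h) - quadP x₀ b Z (ξ + h) ≤ u ξ - quadP x₀ b Z ξ + inner ℝ (d + q1) h +
          inner ℝ (cl X h) h / 2 + ε * ‖h‖ ^ 2)
    (hjv : ∀ ε > 0, ∃ r > 0, ∀ h : En n, ‖h‖ < r → η + h ∈ K →
        -σ * v (η + h) ≤ -σ * v η + inner ℝ (-d + q2) h + inner ℝ (cl Y h) h / 2
          + ε * ‖h‖ ^ 2)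
    (hXl : ∀ h : En n, -k * ‖h‖ ^ 2 ≤ inner ℝ (cl X h) h)
    (hYl : ∀ h : En n, -k * ‖h‖ ^ 2 ≤ inner ℝ (cl Y h) h)
    (hXY : ∀ h h' : En n, inner ℝ (cl X h) h + inner ℝ (cl Y h') h' ≤ k * ‖h - h'‖ ^ 2)
    (hc : 0 < (1 - σ) * cbar - ω ‖ξ - η‖) :
    f ξ - σ * f η ≤ pucci lam Lam Z + ωR (‖ξ - η‖ + k / 3 * ‖ξ - η‖ ^ 2) + ω ‖ξ - η‖ +
      γ₁ * ‖b + cl Z (ξ - x₀) + q1 + q2‖ + γm * ‖b + cl Z (ξ - x₀) + q1 + q2‖ ^ m +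
      (m - 1) ^ (m - 1) * γm ^ m * ‖b + cl Z (ξ - x₀) + q1 + q2‖ ^ m /
        (m ^ m * ((1 - σ) * cbar - ω ‖ξ - η‖) ^ (m - 1)) + (1 - σ) * A
      - |u ξ| ^ (s - 1) * u ξ + σ * (|v η| ^ (s - 1) * v η) := by
  have hLam : 0 < Lam := hlam.trans_le hlamLam
  have hσ0 : 0 < σ := hσ₀.1.trans hσ.1
  have hσ1 : σ ∈ Set.Ioo (0 : ℝ) 1 := ⟨hσ0, hσ.2⟩
  have hmem : ∀ {ζ : En n}, K ∈ 𝓝 ζ → ∃ r > 0, ∀ h : En n, ‖h‖ < r → ζ + h ∈ K := by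
    intro ζ hζ
    obtain ⟨r, hr, hb⟩ := Metric.mem_nhds_iff.1 hζ
    exact ⟨r, hr, fun h hh => hb (by simpa [mem_ball_iff_norm] using hh)⟩
  have h1 : f ξ ≤ F ξ (X + Z) + H ξ (d + q1 + (b + cl Z (ξ - x₀))) - |u ξ| ^ (s - 1) * u ξ := by
    refine sub_jet hLam hFell husub (hX.add hZ) fun ε hε => ?_
    obtain ⟨r1, hr1, H1⟩ := hju ε hε
    obtain ⟨r2, hr2, H2⟩ := hmem hξK
    refine ⟨min r1 r2, lt_min hr1 hr2, fun h hh => ?_⟩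
    have h3 := H1 h (hh.trans_le (min_le_left _ _)) (H2 h (hh.trans_le (min_le_right _ _)))
    rw [quadP_add x₀ b hZ] at h3
    rw [cl_add, add_apply, inner_add_left (d + q1), inner_add_left (cl X h)]
    linarith
  set p : En n := d - q2 with hp
  have h2 : F η (σ⁻¹ • (-Y)) + H η (σ⁻¹ • p) - |v η| ^ (s - 1) * v η ≤ f η := by
    refine super_jet hLam hFell hvsup (hY.neg.smul _) fun ε hε => ?_
    obtain ⟨r1, hr1, H1⟩ := hjv (σ * ε) (by positivity)
    obtain ⟨r2, hr2, H2⟩ := hmem hηK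
    refine ⟨min r1 r2, lt_min hr1 hr2, fun h hh => ?_⟩
    have h3 := H1 h (hh.trans_le (min_le_left _ _)) (H2 h (hh.trans_le (min_le_right _ _)))
    have h4 : -d + q2 = -p := by rw [hp]; abel
    rw [h4, inner_neg_left] at h3
    rw [cl_smul, cl_neg, smul_apply, neg_apply, inner_smul_left, inner_smul_left, inner_neg_left]
    simp only [conj_trivial]
    have h5 : σ * (v η + σ⁻¹ * inner ℝ p h + σ⁻¹ * -inner ℝ (cl Y h) h / 2 - ε * ‖h‖ ^ 2) ≤
        σ * v (η + h) := by
      have : σ * (v η + σ⁻¹ * inner ℝ p h + σ⁻¹ * -inner ℝ (cl Y h) h / 2 - ε * ‖h‖ ^ 2) =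
        σ * v η + inner ℝ p h - inner ℝ (cl Y h) h / 2 - σ * ε * ‖h‖ ^ 2 := by
        field_simp
        try ring
      rw [this]; linarith
    exact le_of_mul_le_mul_left h5 hσ0
  have h3 : F ξ (X + Z) - F ξ X ≤ pucci lam Lam Z :=
    F_le_pucci hlam hlamLam (hFell ξ) hX hZ
  have h4 : F ξ X - F η (-Y) ≤ ωR (‖ξ - η‖ + k / 3 * ‖ξ - η‖ ^ 2) := by
    have e : (3 : ℝ) / (3 / k) = k := by field_simp
    have := hFstruct (3 / k) (by positivity) ξ η X (-Y) hξR hηR hX hY.neg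
      (by rw [e, neg_neg]; exact block_lower hX hY hXl hYl)
      (by rw [e, neg_neg]; exact block_upper hX hY hXY)
    rwa [inv_div] at this
  have h5 : F η (-Y) = σ * F η (σ⁻¹ • (-Y)) := by
    rw [← hFhom σ hσ1, smul_smul, mul_inv_cancel₀ hσ0.ne', one_smul]
  set q : En n := b + cl Z (ξ - x₀) + q1 + q2 with hq
  have e6 : d + q1 + (b + cl Z (ξ - x₀)) = p + q := by rw [hp, hq]; abel
  rw [e6] at h1
  have h6 := (abs_le.1 (hHstruct ξ η p q)).2
  have h7 := hHconv η p σ hσ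
  have h8 := young_weighted hm hγm hc (norm_nonneg p) (norm_nonneg q)
  have e9 : ‖q‖ ^ m = ‖q‖ ^ (m - 1) * ‖q‖ := by
    have : m = (m - 1) + 1 := by ring
    conv_lhs => rw [this, rpow_add' (norm_nonneg _) (by linarith), rpow_one]
  have h9 := mul_le_mul_of_nonneg_left h2 hσ0.le
  rw [h5] at h4
  rw [show γm * ‖q‖ ^ m = γm * (‖q‖ ^ (m - 1) * ‖q‖) by rw [e9]]
  linarith

lemma core_ineq {lam Lam m s γ₁ γm cbar A σ₀ : ℝ} {ω : ℝ → ℝ}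
    {F : En n → Matrix (Fin n) (Fin n) ℝ → ℝ}
    {H : En n → En n → ℝ} {f u v : En n → ℝ}
    (hlam : 0 < lam) (hlamLam : lam ≤ Lam) (hm : 1 < m) (hs : 1 < s)
    (hFell : ∀ (x : En n) (X Y : Matrix (Fin n) (Fin n) ℝ), X.IsSymm → Y.IsSymm →
      Y.PosSemidef →
      lam * Y.trace ≤ F x (X + Y) - F x X ∧ F x (X + Y) - F x X ≤ Lam * Y.trace)
    (hFstruct : ∀ R > (0 : ℝ), ∃ ωR : ℝ → ℝ, IsModulus ωR ∧
      ∀ ε > (0 : ℝ), ∀ (x y : En n) (X Y : Matrix (Fin n) (Fin n) ℝ),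
        ‖x‖ < R → ‖y‖ < R → X.IsSymm → Y.IsSymm →
        (Matrix.fromBlocks X 0 0 (-Y) +
          (3 / ε) • (1 : Matrix (Fin n ⊕ Fin n) (Fin n ⊕ Fin n) ℝ)).PosSemidef →
        ((3 / ε) • Matrix.fromBlocks (1 : Matrix (Fin n) (Fin n) ℝ) (-1) (-1) 1 -
          Matrix.fromBlocks X 0 0 (-Y)).PosSemidef →
        F x X - F y Y ≤ ωR (‖x - y‖ + ε⁻¹ * ‖x - y‖ ^ 2))
    (hFhom : ∀ σ ∈ Set.Ioo (0 : ℝ) 1, ∀ (x : En n) (X : Matrix (Fin n) (Fin n) ℝ),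
      F x (σ • X) = σ * F x X)
    (hγm : 0 < γm) (hω : IsModulus ω)
    (hHstruct : ∀ x y p q : En n,
      |H x (p + q) - H y p| ≤ ω ‖x - y‖ * (‖p‖ ^ m + 1) +
        (γ₁ + γm * (‖p‖ ^ (m - 1) + ‖q‖ ^ (m - 1))) * ‖q‖)
    (hcbar : 0 < cbar) (hσ₀ : σ₀ ∈ Set.Ioo (0 : ℝ) 1)
    (hHconv : ∀ (x p : En n), ∀ σ ∈ Set.Ioo σ₀ 1,
      H x p - σ * H x (σ⁻¹ • p) ≤ (1 - σ) * (-cbar * ‖p‖ ^ m + A))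
    (hf : Continuous f)
    (hu : Continuous u) (husub : ViscositySubsolution F H s f u)
    (hv : Continuous v) (hvsup : ViscositySupersolution F H s f v)
    {σ : ℝ} (hσ : σ ∈ Set.Ioo σ₀ 1) {x₀ b : En n} {Z : Matrix (Fin n) (Fin n) ℝ} (hZ : Z.IsSymm)
    {ρ e0 : ℝ} (hρ : 0 < ρ) (he0 : 0 < e0)
    (hmax : ∀ a ∈ Metric.closedBall x₀ ρ,
      u a - σ * v a - quadP x₀ b Z a ≤ u x₀ - σ * v x₀ - e0 * ‖a - x₀‖ ^ 2) :
    f x₀ - σ * f x₀ ≤ pucci lam Lam Z + γ₁ * ‖b‖ + γm * ‖b‖ ^ m +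
      (m - 1) ^ (m - 1) * γm ^ m * ‖b‖ ^ m / (m ^ m * ((1 - σ) * cbar) ^ (m - 1)) + (1 - σ) * A
      - |u x₀| ^ (s - 1) * u x₀ + σ * (|v x₀| ^ (s - 1) * v x₀) := by
  have hQc : Continuous (quadP x₀ b Z) := (quadP_contDiff x₀ b Z).continuous
  have hu1 : Continuous fun a => u a - quadP x₀ b Z a := hu.sub hQc
  have hv1 : Continuous fun a => -σ * v a := continuous_const.mul hv
  have hx₀K : x₀ ∈ Metric.closedBall x₀ ρ := Metric.mem_closedBall_self hρ.le
  have hall := fun N : ℕ => sums (isCompact_closedBall x₀ ρ) ⟨x₀, hx₀K⟩ hu1 hv1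
    (k := (N : ℝ) + 1) (ε := 1 / ((N : ℝ) + 1)) (by positivity) (by positivity)
  choose q1 q2 x y ξ η X Y hq1 hq2 hξK hηK hX hY e1 e2 hM hju hjv hXl hYl hXY using hall
  obtain ⟨hξl, hηl, hkl⟩ := penal_limit (x := x) (y := y) hρ he0
    (u1 := fun a => u a - quadP x₀ b Z a) (v1 := fun a => -σ * v a) hv1
    (fun a ha => by
      have := hmax a ha
      have h0 : quadP x₀ b Z x₀ = 0 := by simp [quadP]
      rw [h0]; linarith) hq1 hq2 hξK hηK
    (fun N => by
      have := hM N x₀ hx₀K x₀ hx₀K x₀ x₀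
      simpa using this)
  obtain ⟨ωR, hωR, hFs⟩ := hFstruct (‖x₀‖ + 1) (by positivity)
  have hmod : ∀ {w : ℝ → ℝ} {g : ℕ → ℝ}, IsModulus w → (∀ N, 0 ≤ g N) →
      Tendsto g atTop (𝓝 0) → Tendsto (fun N => w (g N)) atTop (𝓝 0) := by
    intro w g hw hg hgl
    have h1 := hw.2.2.2
    unfold ContinuousWithinAt at h1
    rw [hw.2.2.1] at h1
    exact h1.comp (tendsto_nhdsWithin_iff.2 ⟨hgl, Eventually.of_forall hg⟩)
  have hdl : Tendsto (fun N => ‖ξ N - η N‖) atTop (𝓝 0) := by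
    have := (hξl.sub hηl).norm
    simpa using this
  have hωl : Tendsto (fun N => ω ‖ξ N - η N‖) atTop (𝓝 0) := hmod hω (fun N => norm_nonneg _) hdl
  have hωRl : Tendsto (fun N : ℕ => ωR (‖ξ N - η N‖ + ((N : ℝ) + 1) / 3 * ‖ξ N - η N‖ ^ 2))
      atTop (𝓝 0) := by
    refine hmod hωR (fun N => by positivity) ?_
    have := hdl.add (hkl.const_mul (1 / 3))
    simp only [mul_zero, add_zero] at this
    refine this.congr fun N => ?_
    ring
  have hq : ∀ {q : ℕ → En n}, (∀ N : ℕ, ‖q N‖ < 1 / ((N : ℝ) + 1)) → Tendsto q atTop (𝓝 0) := by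
    intro q hq
    exact squeeze_zero_norm (fun N => (hq N).le) tendsto_one_div_add_atTop_nhds_zero_nat
  have hbl : Tendsto (fun N => b + cl Z (ξ N - x₀) + q1 N + q2 N) atTop (𝓝 b) := by
    have h1 : Tendsto (fun N => cl Z (ξ N - x₀)) atTop (𝓝 (cl Z (x₀ - x₀))) :=
      ((cl Z).continuous.tendsto _).comp (hξl.sub_const x₀)
    have := ((h1.const_add b).add (hq hq1)).add (hq hq2)
    simpa using this
  have hbn := hbl.norm
  have hbm : Tendsto (fun N => ‖b + cl Z (ξ N - x₀) + q1 N + q2 N‖ ^ m) atTop (𝓝 (‖b‖ ^ m)) :=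
    hbn.rpow_const (Or.inr (by linarith))
  have hc0 : 0 < (1 - σ) * cbar := mul_pos (by linarith [hσ.2]) hcbar
  have hcl : Tendsto (fun N => (1 - σ) * cbar - ω ‖ξ N - η N‖) atTop (𝓝 ((1 - σ) * cbar)) := by
    simpa using hωl.const_sub ((1 - σ) * cbar)
  have hcm : Tendsto (fun N => ((1 - σ) * cbar - ω ‖ξ N - η N‖) ^ (m - 1)) atTop
      (𝓝 (((1 - σ) * cbar) ^ (m - 1))) := hcl.rpow_const (Or.inl hc0.ne')
  have hzero : ∀ {w : En n → ℝ}, Continuous w → Continuous fun a => |w a| ^ (s - 1) * w a := by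
    intro w hw
    exact (hw.abs.rpow_const fun a => Or.inr (by linarith)).mul hw
  have hUl := ((hzero hu).tendsto x₀).comp hξl
  have hVl := ((hzero hv).tendsto x₀).comp hηl
  have hfl := (((hf.tendsto x₀).comp hξl).sub (((hf.tendsto x₀).comp hηl).const_mul σ))
  have hden : m ^ m * ((1 - σ) * cbar) ^ (m - 1) ≠ 0 := by
    have : 0 < m := by linarith
    positivity
  have hR := ((((((((tendsto_const_nhds (x := pucci lam Lam Z)).add hωRl).add hωl).add
    (hbn.const_mul γ₁)).add (hbm.const_mul γm)).add
    ((hbm.const_mul ((m - 1) ^ (m - 1) * γm ^ m)).div (hcm.const_mul (m ^ m)) hden)).add_const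
    ((1 - σ) * A)).sub hUl).add (hVl.const_mul σ)
  rw [add_zero, add_zero] at hR
  refine le_of_tendsto_of_tendsto hfl hR ?_
  have hballK : Metric.ball x₀ ρ ∈ 𝓝 x₀ := Metric.ball_mem_nhds _ hρ
  have hnb : ∀ᶠ z in 𝓝 x₀, ‖z‖ < ‖x₀‖ + 1 :=
    (continuous_norm.tendsto x₀).eventually_lt_const (by linarith)
  filter_upwards [hξl.eventually hballK, hηl.eventually hballK, hξl.eventually hnb,
    hηl.eventually hnb, hcl.eventually_const_lt hc0] with N h1 h2 h3 h4 h5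
  have hnear : ∀ {z : En n}, z ∈ Metric.ball x₀ ρ → Metric.closedBall x₀ ρ ∈ 𝓝 z := fun hz =>
    Filter.mem_of_superset (Metric.isOpen_ball.mem_nhds hz) Metric.ball_subset_closedBall
  have hneg : -(((N : ℝ) + 1) • (x N - y N)) = ((N : ℝ) + 1) • (y N - x N) := by
    rw [← smul_neg, neg_sub]
  exact level_ineq hlam hlamLam hm hFell hFs hFhom hγm hHstruct hσ₀ hHconv husub hvsup hσ hZ
    (k := (N : ℝ) + 1) (d := ((N : ℝ) + 1) • (x N - y N))
    (by positivity) (hX N) (hY N) (hnear h1) (hnear h2) h3 h4 (hju N)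
    (by rw [hneg]; exact hjv N) (hXl N) (hYl N) (hXY N) h5

end Final
theorem linearization_lemma
    (n : ℕ) (hn : 1 ≤ n) (lam Lam m s γ₁ γm cbar A σ₀ γt : ℝ) (ω : ℝ → ℝ)
    (F : En n → Matrix (Fin n) (Fin n) ℝ → ℝ)
    (H : En n → En n → ℝ) (f u v : En n → ℝ)
    (hlam : 0 < lam) (hlamLam : lam ≤ Lam) (hm : 1 < m) (hs : 1 < s)
    -- (i) uniform ellipticity
    (hFell : ∀ (x : En n) (X Y : Matrix (Fin n) (Fin n) ℝ), X.IsSymm → Y.IsSymm →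
      Y.PosSemidef →
      lam * Y.trace ≤ F x (X + Y) - F x X ∧ F x (X + Y) - F x X ≤ Lam * Y.trace)
    -- (ii)
    (hFcont : ∀ X : Matrix (Fin n) (Fin n) ℝ, X.IsSymm → Continuous fun x => F x X)
    -- (iii) structure condition
    (hFstruct : ∀ R > (0 : ℝ), ∃ ωR : ℝ → ℝ, IsModulus ωR ∧
      ∀ ε > (0 : ℝ), ∀ (x y : En n) (X Y : Matrix (Fin n) (Fin n) ℝ),
        ‖x‖ < R → ‖y‖ < R → X.IsSymm → Y.IsSymm →
        (Matrix.fromBlocks X 0 0 (-Y) +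
          (3 / ε) • (1 : Matrix (Fin n ⊕ Fin n) (Fin n ⊕ Fin n) ℝ)).PosSemidef →
        ((3 / ε) • Matrix.fromBlocks (1 : Matrix (Fin n) (Fin n) ℝ) (-1) (-1) 1 -
          Matrix.fromBlocks X 0 0 (-Y)).PosSemidef →
        F x X - F y Y ≤ ωR (‖x - y‖ + ε⁻¹ * ‖x - y‖ ^ 2))
    -- (iv) positive homogeneity
    (hFhom : ∀ σ ∈ Set.Ioo (0 : ℝ) 1, ∀ (x : En n) (X : Matrix (Fin n) (Fin n) ℝ),
      F x (σ • X) = σ * F x X)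
    (hγ₁ : 0 < γ₁) (hγm : 0 < γm) (hω : IsModulus ω)
    -- (a) structure condition on H
    (hHstruct : ∀ x y p q : En n,
      |H x (p + q) - H y p| ≤ ω ‖x - y‖ * (‖p‖ ^ m + 1) +
        (γ₁ + γm * (‖p‖ ^ (m - 1) + ‖q‖ ^ (m - 1))) * ‖q‖)
    -- (b) convexity-type condition on H
    (hcbar : 0 < cbar) (hA : 0 < A) (hσ₀ : σ₀ ∈ Set.Ioo (0 : ℝ) 1)
    (hHconv : ∀ (x p : En n), ∀ σ ∈ Set.Ioo σ₀ 1,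
      H x p - σ * H x (σ⁻¹ • p) ≤ (1 - σ) * (-cbar * ‖p‖ ^ m + A))
    (hf : Continuous f)
    (hu : Continuous u) (husub : ViscositySubsolution F H s f u)
    (hv : Continuous v) (hvsup : ViscositySupersolution F H s f v)
    (hγt : γt = γm + (m - 1) ^ (m - 1) * γm ^ m / (m ^ m * cbar ^ (m - 1))) :
    ∀ σ ∈ Set.Ioo σ₀ 1, ∀ φ : En n → ℝ, ContDiff ℝ 2 φ →
      ∀ x₀ : En n, IsLocalMax ((fun x => u x - σ * v x) - φ) x₀ →
        pucci lam Lam (hessianMatrix φ x₀) + γ₁ * ‖gradient φ x₀‖ +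
          (1 - σ) ^ (1 - m) * γt * ‖gradient φ x₀‖ ^ m -
          (|u x₀| ^ (s - 1) * u x₀ - |σ * v x₀| ^ (s - 1) * (σ * v x₀)) +
          (σ - σ ^ s) * (|v x₀| ^ (s - 1) * v x₀) ≥ (1 - σ) * (f x₀ - A) := by
  intro σ hσ φ hφ x₀ hloc
  have hσ0 : 0 < σ := hσ₀.1.trans hσ.1
  have hLam : 0 < Lam := hlam.trans_le hlamLam
  have h1σ : 0 < 1 - σ := by linarith [hσ.2]
  have hm0 : 0 < m := by linarith
  have hZ0 : (hessianMatrix φ x₀).IsSymm := hessian_symm hφ x₀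
  have key : ∀ c : ℝ, 0 < c → f x₀ - σ * f x₀ ≤
      (pucci lam Lam (hessianMatrix φ x₀) + c * (Lam * n)) + γ₁ * ‖gradient φ x₀‖ +
      γm * ‖gradient φ x₀‖ ^ m +
      (m - 1) ^ (m - 1) * γm ^ m * ‖gradient φ x₀‖ ^ m / (m ^ m * ((1 - σ) * cbar) ^ (m - 1)) +
      (1 - σ) * A
      - |u x₀| ^ (s - 1) * u x₀ + σ * (|v x₀| ^ (s - 1) * v x₀) := by
    intro c hc
    obtain ⟨r1, hr1, ht⟩ := taylor_two hφ x₀ (c / 4) (show 0 < c / 4 by positivity)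
    obtain ⟨r2, hr2, hl⟩ := Metric.eventually_nhds_iff.1 hloc
    have hρ : 0 < min r1 r2 / 2 := by have := lt_min hr1 hr2; positivity
    have hs1 : (c • (1 : Matrix (Fin n) (Fin n) ℝ)).IsSymm := Matrix.isSymm_one.smul _
    have h1 := core_ineq hlam hlamLam hm hs hFell hFstruct hFhom hγm hω hHstruct hcbar hσ₀ hHconv
      hf hu husub hv hvsup hσ (x₀ := x₀) (b := gradient φ x₀)
      (Z := hessianMatrix φ x₀ + c • (1 : Matrix (Fin n) (Fin n) ℝ)) (hZ0.add hs1) hρ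
      (show 0 < c / 4 by positivity) (by
        intro a ha
        rw [mem_closedBall_iff_norm] at ha
        have ha' : ‖a - x₀‖ < min r1 r2 := by linarith
        have g1 := ht (a - x₀) (ha'.trans_le (min_le_left _ _))
        have g2 := hl (y := a) (by rw [dist_eq_norm]; exact ha'.trans_le (min_le_right _ _))
        simp only [Pi.sub_apply] at g2
        rw [add_sub_cancel] at g1
        simp only [quadP, sub_zero] at g1 ⊢
        rw [cl_add, cl_smul, cl_one]
        simp only [add_apply, smul_apply, ContinuousLinearMap.id_apply, inner_add_left,
          inner_smul_left, conj_trivial, real_inner_self_eq_norm_sq]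
        linarith)
    have h2 := pucci_add_smul hlam hlamLam hZ0 hc.le
    linarith
  have key2 : f x₀ - σ * f x₀ ≤
      pucci lam Lam (hessianMatrix φ x₀) + γ₁ * ‖gradient φ x₀‖ +
      γm * ‖gradient φ x₀‖ ^ m +
      (m - 1) ^ (m - 1) * γm ^ m * ‖gradient φ x₀‖ ^ m / (m ^ m * ((1 - σ) * cbar) ^ (m - 1)) +
      (1 - σ) * A
      - |u x₀| ^ (s - 1) * u x₀ + σ * (|v x₀| ^ (s - 1) * v x₀) := by
    refine le_of_forall_pos_le_add fun δ hδ => ?_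
    have hn0 : (0 : ℝ) < n := by exact_mod_cast hn
    have h1 := key (δ / (Lam * n)) (by positivity)
    have h2 : δ / (Lam * n) * (Lam * n) = δ := by field_simp
    rw [h2] at h1
    linarith
  set g := ‖gradient φ x₀‖ with hg
  have hg0 : 0 ≤ g := norm_nonneg _
  have hgm : 0 ≤ g ^ m := rpow_nonneg hg0 _
  have ezero : |σ * v x₀| ^ (s - 1) * (σ * v x₀) = σ ^ s * (|v x₀| ^ (s - 1) * v x₀) := by
    have : σ ^ s = σ ^ (s - 1) * σ := by
      rw [← rpow_add_one hσ0.ne']; congr 1; ring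
    rw [abs_mul, abs_of_pos hσ0, mul_rpow hσ0.le (abs_nonneg _), this]
    ring
  have einv : (1 - σ) ^ (1 - m) = ((1 - σ) ^ (m - 1))⁻¹ := by
    rw [← rpow_neg h1σ.le]; congr 1; ring
  have hge : 1 ≤ (1 - σ) ^ (1 - m) :=
    one_le_rpow_of_pos_of_le_one_of_nonpos h1σ (by linarith) (by linarith)
  have eY : (m - 1) ^ (m - 1) * γm ^ m * g ^ m / (m ^ m * ((1 - σ) * cbar) ^ (m - 1)) =
      (1 - σ) ^ (1 - m) * ((m - 1) ^ (m - 1) * γm ^ m / (m ^ m * cbar ^ (m - 1))) * g ^ m := by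
    rw [mul_rpow h1σ.le hcbar.le, einv]
    have i1 : 0 < (1 - σ) ^ (m - 1) := rpow_pos_of_pos h1σ _
    have i2 : 0 < cbar ^ (m - 1) := rpow_pos_of_pos hcbar _
    have i3 : 0 < m ^ m := rpow_pos_of_pos hm0 _
    field_simp
  rw [eY] at key2
  have h5 : γm * g ^ m ≤ (1 - σ) ^ (1 - m) * (γm * g ^ m) :=
    le_mul_of_one_le_left (by positivity) hge
  have h6 : (1 - σ) ^ (1 - m) * γt * g ^ m = (1 - σ) ^ (1 - m) * (γm * g ^ m) +
      (1 - σ) ^ (1 - m) * ((m - 1) ^ (m - 1) * γm ^ m / (m ^ m * cbar ^ (m - 1))) * g ^ m := by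
    rw [hγt]; ring
  rw [ge_iff_le, h6, ezero]
  linarith
end
end
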